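/- arXiv:2003.11749 — 7 statements merged into one kernel-verified Lean document; each statement's English description precedes it below -/
import Mathlib

section
/- Let n ≥ 1 be an even integer and c ≥ 1 an integer. Then the expected number of monochromatic Schur triples over a uniformly random c-coloring of {1,…,n} satisfies E[X] = n(n−2+2c)/(4c²). -/
open Finset

/-- The number of monochromatic Schur triples of a coloring `χ : Fin n → Fin c` of `{1,…,n}`
(position `x : Fin n` represents the integer `x.val + 1`): triples `(x, y, z)` of positions with
values `x+1 ≤ y+1`, `(x+1) + (y+1) = z+1` (hence `x+y+1 = z` on indices, and automatically
`(x+1)+(y+1) ≤ n`), all three of the same color. -/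
def schurCount (n c : ℕ) (χ : Fin n → Fin c) : ℕ :=
  ((univ : Finset (Fin n × Fin n × Fin n)).filter
    (fun p => p.1.val ≤ p.2.1.val ∧ p.1.val + p.2.1.val + 1 = p.2.2.val ∧
      χ p.1 = χ p.2.1 ∧ χ p.2.1 = χ p.2.2)).card

/-- The number of `κ`-colorings of `α` that are constant on a nonempty set `s`. -/
theorem card_constant_on_mul_pow {α κ : Type*} [Fintype α] [DecidableEq α] [Fintype κ]
    [DecidableEq κ] {s : Finset α} (hs : s.Nonempty) :
    #{χ : α → κ | ∃ k, ∀ i ∈ s, χ i = k} * Fintype.card κ ^ #s =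
      Fintype.card κ * Fintype.card κ ^ Fintype.card α := by
  obtain ⟨a, ha⟩ := hs
  have fiber (k : κ) : #{χ ∈ ({χ : α → κ | ∃ k, ∀ i ∈ s, χ i = k} : Finset _) | χ a = k} =
      Fintype.card κ ^ #sᶜ := by
    have : {χ ∈ ({χ : α → κ | ∃ k, ∀ i ∈ s, χ i = k} : Finset _) | χ a = k} =
        Fintype.piFinset fun i => if i ∈ s then {k} else univ := by
      ext χ
      simp only [mem_filter, mem_univ, true_and, Fintype.mem_piFinset]
      constructor
      · rintro ⟨⟨l, hl⟩, rfl⟩ i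
        by_cases hi : i ∈ s <;> simp [hi, hl a ha, hl i]
      · intro h
        have hk (i : α) (hi : i ∈ s) : χ i = k := by simpa [hi] using h i
        exact ⟨⟨k, hk⟩, hk a ha⟩
    rw [this, Fintype.card_piFinset]
    simp [apply_ite Finset.card, prod_ite, filter_not, compl_eq_univ_sdiff]
  rw [card_eq_sum_card_fiberwise (f := fun χ => χ a) (t := univ) (by simp)]
  simp only [fiber, sum_const, card_univ, smul_eq_mul]
  rw [mul_assoc, ← pow_add, card_compl, Nat.sub_add_cancel (card_le_univ s)]

theorem card_monochromatic_triple {n c : ℕ} (hc : 1 ≤ c) (x y z : Fin n) :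
    (#{χ : Fin n → Fin c | χ x = χ y ∧ χ y = χ z} : ℚ) =
      c ^ n * (c / c ^ #({x, y, z} : Finset (Fin n))) := by
  have h := card_constant_on_mul_pow (κ := Fin c) (s := {x, y, z}) (by simp)
  have constant_iff (χ : Fin n → Fin c) :
      (∃ k, ∀ i ∈ ({x, y, z} : Finset (Fin n)), χ i = k) ↔ χ x = χ y ∧ χ y = χ z := by
    simp only [mem_insert, mem_singleton, forall_eq_or_imp, forall_eq]
    grind
  simp only [constant_iff, Fintype.card_fin] at h
  have hc0 : (c : ℚ) ≠ 0 := by positivity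
  rw [← mul_div_assoc, eq_div_iff (by positivity), mul_comm ((c : ℚ) ^ n)]
  exact_mod_cast h

theorem sum_range_two_mul_div_two (m : ℕ) : ∑ z ∈ range (2 * m), z / 2 + m = m * m := by
  induction m with
  | zero => simp
  | succ m ih =>
    rw [Nat.mul_succ, sum_range_succ, sum_range_succ, Nat.mul_div_cancel_left m two_pos,
      show (2 * m + 1) / 2 = m by lia]
    linarith

theorem card_diagonal_schur_triples (m : ℕ) :
    #{p : Fin (2 * m) × Fin (2 * m) × Fin (2 * m) |
      p.1.val = p.2.1.val ∧ p.1.val + p.2.1.val + 1 = p.2.2.val} = m := by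
  conv_rhs => rw [← card_range m]
  refine card_bij (fun p _ => p.1.val) ?_ ?_ ?_
  · rintro ⟨x, y, z⟩ h
    simp only [mem_filter, mem_univ, true_and, mem_range] at h ⊢
    lia
  · rintro ⟨x, y, z⟩ h ⟨x', y', z'⟩ h' e
    simp only [mem_filter, mem_univ, true_and, Prod.mk.injEq, Fin.ext_iff] at h h' e ⊢
    lia
  · intro x hx
    rw [mem_range] at hx
    exact ⟨(⟨x, by lia⟩, ⟨x, by lia⟩, ⟨2 * x + 1, by lia⟩), by simp; lia, rfl⟩

theorem card_strict_schur_triples (m : ℕ) :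
    #{p : Fin (2 * m) × Fin (2 * m) × Fin (2 * m) |
      p.1.val < p.2.1.val ∧ p.1.val + p.2.1.val + 1 = p.2.2.val} + m = m * m := by
  have h : #((range (2 * m)).sigma fun z => range (z / 2)) + m = m * m := by
    simpa using sum_range_two_mul_div_two m
  rw [← h]
  congr 1
  refine card_bij (fun p _ => ⟨p.2.2.val, p.1.val⟩) ?_ ?_ ?_
  · rintro ⟨x, y, z⟩ h
    simp only [mem_filter, mem_univ, true_and, mem_sigma, mem_range] at h ⊢
    lia
  · rintro ⟨x, y, z⟩ h ⟨x', y', z'⟩ h' e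
    simp only [mem_filter, mem_univ, true_and, Prod.mk.injEq, Fin.ext_iff, Sigma.mk.injEq,
      heq_eq_eq] at h h' e ⊢
    lia
  · rintro ⟨z, x⟩ hx
    simp only [mem_sigma, mem_range] at hx
    refine ⟨(⟨x, by lia⟩, ⟨z - x - 1, by lia⟩, ⟨z, by lia⟩), ?_, rfl⟩
    simp only [mem_filter, mem_univ, true_and]
    lia

theorem sum_schurCount (n c : ℕ) :
    ∑ χ : Fin n → Fin c, schurCount n c χ =
      ∑ p : Fin n × Fin n × Fin n with
          p.1.val ≤ p.2.1.val ∧ p.1.val + p.2.1.val + 1 = p.2.2.val,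
        #{χ : Fin n → Fin c | χ p.1 = χ p.2.1 ∧ χ p.2.1 = χ p.2.2} := by
  have h := sum_card_bipartiteAbove_eq_sum_card_bipartiteBelow
    (s := (univ : Finset (Fin n → Fin c)))
    (t := ({p | p.1.val ≤ p.2.1.val ∧ p.1.val + p.2.1.val + 1 = p.2.2.val} :
      Finset (Fin n × Fin n × Fin n)))
    fun χ p => χ p.1 = χ p.2.1 ∧ χ p.2.1 = χ p.2.2
  simpa only [bipartiteAbove, bipartiteBelow, filter_filter, and_assoc, schurCount] using h

/-- For even `n ≥ 1` and `c ≥ 1`, the expected number of monochromatic Schur triples over a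
uniformly random `c`-coloring of `{1,…,n}` is `n(n−2+2c)/(4c²)`. -/
theorem schur_first_moment_even (n c : ℕ) (hn : 1 ≤ n) (heven : Even n) (hc : 1 ≤ c) :
    (∑ χ : Fin n → Fin c, (schurCount n c χ : ℚ)) / (c : ℚ) ^ n =
      (n : ℚ) * ((n : ℚ) - 2 + 2 * c) / (4 * (c : ℚ) ^ 2) := by
  obtain ⟨m, rfl⟩ := heven.exists_two_nsmul
  rw [smul_eq_mul] at *
  have hc0 : (c : ℚ) ≠ 0 := by positivity
  rw [← Nat.cast_sum, sum_schurCount, Nat.cast_sum]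
  have split : ({p : Fin (2 * m) × Fin (2 * m) × Fin (2 * m) |
      p.1.val ≤ p.2.1.val ∧ p.1.val + p.2.1.val + 1 = p.2.2.val} : Finset _) =
      ({p | p.1.val = p.2.1.val ∧ p.1.val + p.2.1.val + 1 = p.2.2.val} : Finset _) ∪
      ({p | p.1.val < p.2.1.val ∧ p.1.val + p.2.1.val + 1 = p.2.2.val} : Finset _) := by
    ext p
    simp only [mem_filter, mem_univ, true_and, mem_union]
    lia
  rw [split, sum_union (disjoint_filter.2 fun p _ h h' => h'.1.ne h.1)]
  have diagonal : ∀ p ∈ ({p : Fin (2 * m) × Fin (2 * m) × Fin (2 * m) |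
      p.1.val = p.2.1.val ∧ p.1.val + p.2.1.val + 1 = p.2.2.val} : Finset _),
      (#{χ : Fin (2 * m) → Fin c | χ p.1 = χ p.2.1 ∧ χ p.2.1 = χ p.2.2} : ℚ) =
        c ^ (2 * m) * (c / c ^ 2) := by
    rintro ⟨x, y, z⟩ h
    simp only [mem_filter, mem_univ, true_and] at h
    have hxy : x = y := Fin.ext h.1
    have hyz : y ≠ z := fun e => by rw [← e] at h; lia
    rw [card_monochromatic_triple hc, hxy, insert_idem, card_pair hyz]
  have strict : ∀ p ∈ ({p : Fin (2 * m) × Fin (2 * m) × Fin (2 * m) |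
      p.1.val < p.2.1.val ∧ p.1.val + p.2.1.val + 1 = p.2.2.val} : Finset _),
      (#{χ : Fin (2 * m) → Fin c | χ p.1 = χ p.2.1 ∧ χ p.2.1 = χ p.2.2} : ℚ) =
        c ^ (2 * m) * (c / c ^ 3) := by
    rintro ⟨x, y, z⟩ h
    simp only [mem_filter, mem_univ, true_and] at h
    have hcard : #({x, y, z} : Finset (Fin (2 * m))) = 3 :=
      card_eq_three.2 ⟨x, y, z, by lia, by lia, by lia, rfl⟩
    rw [card_monochromatic_triple hc, hcard]
  have hstrict := congrArg (Nat.cast (R := ℚ)) (card_strict_schur_triples m)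
  push_cast at hstrict
  rw [sum_congr rfl diagonal, sum_congr rfl strict, sum_const, sum_const, nsmul_eq_mul,
    nsmul_eq_mul, card_diagonal_schur_triples, eq_sub_of_add_eq hstrict]
  push_cast
  field_simp
  ring
end

section
/- Let n ≥ 1 be an integer with n ≡ 1 (mod 12) and let c ≥ 1 be an integer. Then the second moment of the number of monochromatic Schur triples over a uniformly random c-coloring of {1,…,n} satisfies E[X²] = (n−1)(24c³ − 76c − 27n + 65 − 9n² + 12cn² + 24c²n + 3n³ − 16c²)/(48c⁴). -/
open Finset

/-- A coloring is constant on a finite set of positions. -/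
def MonoOn {ι κ : Type*} (χ : ι → κ) (A : Finset ι) : Prop :=
  ∀ i ∈ A, ∀ j ∈ A, χ i = χ j

section Colorings

variable {ι κ : Type*} [Fintype ι] [DecidableEq ι] [Fintype κ] [DecidableEq κ]

instance (χ : ι → κ) (A : Finset ι) : Decidable (MonoOn χ A) := by
  unfold MonoOn; infer_instance

lemma card_prescribed_mul (U : Finset ι) (g : ι → κ) :
    (univ.filter fun χ : ι → κ => ∀ i ∈ U, χ i = g i).card * Fintype.card κ ^ U.card =
      Fintype.card κ ^ Fintype.card ι := by
  have h : (univ.filter fun χ : ι → κ => ∀ i ∈ U, χ i = g i) =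
      Fintype.piFinset fun i => if i ∈ U then {g i} else univ := by
    ext χ
    simp only [mem_filter, mem_univ, true_and, Fintype.mem_piFinset]
    refine forall_congr' fun i => ?_
    by_cases hi : i ∈ U <;> simp [hi]
  rw [h, Fintype.card_piFinset]
  have h' : ∀ i, (if i ∈ U then {g i} else univ : Finset κ).card =
      if i ∈ U then 1 else Fintype.card κ := by
    intro i; split_ifs <;> simp
  simp only [h', prod_ite, prod_const_one, one_mul, prod_const]
  rw [← pow_add]
  congr 1
  have := card_filter_add_card_filter_not (s := (univ : Finset ι)) (fun i => i ∈ U)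
  simp only [card_univ, filter_univ_mem] at this
  omega

lemma card_monoOn_of_disjoint {A B : Finset ι} (hA : A.Nonempty) (hB : B.Nonempty)
    (h : Disjoint A B) :
    (univ.filter fun χ : ι → κ => MonoOn χ A ∧ MonoOn χ B).card *
      Fintype.card κ ^ (A ∪ B).card = Fintype.card κ ^ Fintype.card ι * Fintype.card κ ^ 2 := by
  obtain ⟨i, hi⟩ := hA
  obtain ⟨j, hj⟩ := hB
  rw [card_eq_sum_card_fiberwise (f := fun χ : ι → κ => (χ i, χ j)) (t := univ)
    (fun _ _ => by simp), sum_mul]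
  have key : ∀ b : κ × κ, ((univ.filter fun χ : ι → κ => MonoOn χ A ∧ MonoOn χ B).filter
      fun χ => (χ i, χ j) = b) =
      univ.filter fun χ : ι → κ => ∀ k ∈ A ∪ B, χ k = if k ∈ A then b.1 else b.2 := by
    rintro ⟨a, b⟩
    ext χ
    simp only [mem_filter, mem_univ, true_and, mem_union, Prod.mk.injEq]
    unfold MonoOn
    constructor
    · rintro ⟨⟨h1, h2⟩, rfl, rfl⟩ k hk
      by_cases hkA : k ∈ A
      · simpa [hkA] using h1 k hkA i hi
      · simpa [hkA] using h2 k (hk.resolve_left hkA) j hj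
    · intro H
      have HA : ∀ k ∈ A, χ k = a := fun k hk => by simpa [hk] using H k (Or.inl hk)
      have HB : ∀ k ∈ B, χ k = b := fun k hk => by
        simpa [disjoint_right.1 h hk] using H k (Or.inr hk)
      exact ⟨⟨fun k hk l hl => (HA k hk).trans (HA l hl).symm,
        fun k hk l hl => (HB k hk).trans (HB l hl).symm⟩, HA i hi, HB j hj⟩
  simp only [key, card_prescribed_mul]
  simp [sq, mul_comm]

lemma card_monoOn_of_not_disjoint {A B : Finset ι} (h : ¬ Disjoint A B) :
    (univ.filter fun χ : ι → κ => MonoOn χ A ∧ MonoOn χ B).card *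
      Fintype.card κ ^ (A ∪ B).card = Fintype.card κ ^ Fintype.card ι * Fintype.card κ := by
  obtain ⟨i, hi, hi'⟩ := not_disjoint_iff.1 h
  rw [card_eq_sum_card_fiberwise (f := fun χ : ι → κ => χ i) (t := univ)
    (fun _ _ => by simp), sum_mul]
  have key : ∀ a : κ, ((univ.filter fun χ : ι → κ => MonoOn χ A ∧ MonoOn χ B).filter
      fun χ => χ i = a) = univ.filter fun χ : ι → κ => ∀ k ∈ A ∪ B, χ k = a := by
    intro a
    ext χ
    simp only [mem_filter, mem_univ, true_and, mem_union]
    unfold MonoOn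
    constructor
    · rintro ⟨⟨h1, h2⟩, rfl⟩ k (hk | hk)
      · exact h1 k hk i hi
      · exact h2 k hk i hi'
    · intro H
      exact ⟨⟨fun k hk l hl => (H k (Or.inl hk)).trans (H l (Or.inl hl)).symm,
        fun k hk l hl => (H k (Or.inr hk)).trans (H l (Or.inr hl)).symm⟩, H i (Or.inl hi)⟩
  simp only [key, card_prescribed_mul _ (fun _ => _)]
  simp [mul_comm]

end Colorings

/-- The pairs `(x, y)` with `1 ≤ x ≤ y` and `x + y ≤ n`. -/
def schurPairs (n : ℕ) : Finset (ℕ × ℕ) :=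
  (Icc 1 n ×ˢ Icc 1 n).filter fun p => p.1 ≤ p.2 ∧ p.1 + p.2 ≤ n

lemma mem_schurPairs {n : ℕ} {p : ℕ × ℕ} :
    p ∈ schurPairs n ↔ 1 ≤ p.1 ∧ p.1 ≤ p.2 ∧ p.1 + p.2 ≤ n := by
  simp only [schurPairs, mem_filter, mem_product, mem_Icc]
  omega

/-- The set of values `{x, y, x + y}` of a Schur triple. -/
def schurSet (p : ℕ × ℕ) : Finset ℕ := {p.1, p.2, p.1 + p.2}

lemma mem_schurSet {p : ℕ × ℕ} {a : ℕ} :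
    a ∈ schurSet p ↔ a = p.1 ∨ a = p.2 ∨ a = p.1 + p.2 := by
  simp [schurSet]

lemma card_schurSet {n : ℕ} {p : ℕ × ℕ} (hp : p ∈ schurPairs n) :
    (schurSet p).card = if p.1 = p.2 then 2 else 3 := by
  rw [mem_schurPairs] at hp
  unfold schurSet
  split_ifs with h
  · rw [h, insert_eq_of_mem (by simp), card_pair (by omega)]
  · rw [card_eq_three.2 ⟨_, _, _, h, by omega, by omega, rfl⟩]

/-- The positions of `Fin n` whose associated integers lie in `A`. -/
def positions (n : ℕ) (A : Finset ℕ) : Finset (Fin n) := univ.filter fun i => i.val + 1 ∈ A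

lemma mem_positions {n : ℕ} {A : Finset ℕ} {i : Fin n} :
    i ∈ positions n A ↔ i.val + 1 ∈ A := by
  simp [positions]

lemma card_positions {n : ℕ} {A : Finset ℕ} (hA : A ⊆ Icc 1 n) :
    (positions n A).card = A.card := by
  refine card_bij (fun i _ => i.val + 1) (fun i hi => mem_positions.1 hi) ?_ ?_
  · intro i _ j _ h
    exact Fin.ext (by omega)
  · intro a ha
    have := mem_Icc.1 (hA ha)
    refine ⟨⟨a - 1, by omega⟩, ?_, ?_⟩
    · rw [mem_positions]
      simpa [Nat.sub_add_cancel this.1] using ha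
    · simp [Nat.sub_add_cancel this.1]

lemma positions_union (n : ℕ) (A B : Finset ℕ) :
    positions n A ∪ positions n B = positions n (A ∪ B) := by
  ext i; simp [mem_positions]

lemma disjoint_positions {n : ℕ} {A B : Finset ℕ} (hA : A ⊆ Icc 1 n) :
    Disjoint (positions n A) (positions n B) ↔ Disjoint A B := by
  simp only [disjoint_left, mem_positions]
  constructor
  · intro h a ha
    have := mem_Icc.1 (hA ha)
    have h' := @h ⟨a - 1, by omega⟩
    simp only [Nat.sub_add_cancel this.1] at h'
    exact h' ha
  · exact fun h i hi => h hi

lemma schurSet_subset {n : ℕ} {p : ℕ × ℕ} (hp : p ∈ schurPairs n) : schurSet p ⊆ Icc 1 n := by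
  intro a ha
  rw [mem_schurPairs] at hp
  rw [mem_schurSet] at ha
  rw [mem_Icc]
  omega

lemma positions_schurSet_nonempty {n : ℕ} {p : ℕ × ℕ} (hp : p ∈ schurPairs n) :
    (positions n (schurSet p)).Nonempty := by
  rw [← card_pos, card_positions (schurSet_subset hp), card_schurSet hp]
  split_ifs <;> norm_num

lemma schurCount_eq_card (n c : ℕ) (χ : Fin n → Fin c) :
    schurCount n c χ =
      ((schurPairs n).filter fun p => MonoOn χ (positions n (schurSet p))).card := by
  unfold schurCount
  refine card_bij (fun p _ => (p.1.val + 1, p.2.1.val + 1)) ?_ ?_ ?_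
  · rintro ⟨x, y, z⟩ h
    simp only [mem_filter, mem_univ, true_and] at h
    obtain ⟨hxy, hz, h1, h2⟩ := h
    simp only [mem_filter, mem_schurPairs]
    refine ⟨⟨by omega, by omega, by omega⟩, ?_⟩
    have key : ∀ i ∈ positions n (schurSet (x.val + 1, y.val + 1)), χ i = χ z := by
      intro i hi
      rw [mem_positions, mem_schurSet] at hi
      rcases hi with hi | hi | hi
      · rw [show i = x from Fin.ext (by simpa using hi), h1, h2]
      · rw [show i = y from Fin.ext (by simpa using hi), h2]
      · rw [show i = z from Fin.ext (by simp only at hi; omega)]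
    exact fun i hi j hj => (key i hi).trans (key j hj).symm
  · rintro ⟨x, y, z⟩ h ⟨x', y', z'⟩ h' e
    simp only [mem_filter, mem_univ, true_and] at h h'
    simp only [Prod.mk.injEq] at e ⊢
    exact ⟨Fin.ext (by omega), Fin.ext (by omega), Fin.ext (by omega)⟩
  · rintro ⟨x, y⟩ h
    simp only [mem_filter, mem_schurPairs] at h
    obtain ⟨⟨h1, h2, h3⟩, hm⟩ := h
    refine ⟨(⟨x - 1, by omega⟩, ⟨y - 1, by omega⟩, ⟨x + y - 1, by omega⟩), ?_, ?_⟩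
    · simp only [mem_filter, mem_univ, true_and]
      refine ⟨by omega, by omega, hm _ ?_ _ ?_, hm _ ?_ _ ?_⟩ <;>
        · simp only [mem_positions, mem_schurSet]
          omega
    · simp only [Prod.mk.injEq]
      omega

/-- The probability that a random coloring with `c` colors is constant on both `A` and `B`. -/
def monoProb (c : ℚ) (A B : Finset ℕ) : ℚ :=
  (if Disjoint A B then c ^ 2 else c) / c ^ (A ∪ B).card

lemma sum_sq_schurCount (n c : ℕ) (hc : 1 ≤ c) :
    (∑ χ : Fin n → Fin c, (schurCount n c χ : ℚ) ^ 2) / (c : ℚ) ^ n =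
      ∑ p ∈ schurPairs n, ∑ q ∈ schurPairs n, monoProb c (schurSet p) (schurSet q) := by
  have hc0 : (c : ℚ) ≠ 0 := by positivity
  have expand : ∀ χ : Fin n → Fin c, (schurCount n c χ : ℚ) ^ 2 =
      ∑ p ∈ schurPairs n, ∑ q ∈ schurPairs n,
        if MonoOn χ (positions n (schurSet p)) ∧ MonoOn χ (positions n (schurSet q))
        then 1 else 0 := by
    intro χ
    rw [schurCount_eq_card, card_filter, sq]
    push_cast
    rw [sum_mul_sum]
    refine sum_congr rfl fun p _ => sum_congr rfl fun q _ => ?_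
    split_ifs <;> simp_all
  simp only [expand]
  rw [sum_comm, sum_div]
  refine sum_congr rfl fun p hp => ?_
  rw [sum_comm, sum_div]
  refine sum_congr rfl fun q hq => ?_
  rw [sum_boole, monoProb, div_eq_div_iff (by positivity) (by positivity)]
  have hU := card_positions (union_subset (schurSet_subset hp) (schurSet_subset hq))
  rw [← hU, ← positions_union]
  split_ifs with hd
  · have := card_monoOn_of_disjoint (κ := Fin c) (positions_schurSet_nonempty hp)
      (positions_schurSet_nonempty hq) ((disjoint_positions (schurSet_subset hp)).2 hd)
    simp only [Fintype.card_fin] at this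
    rw [mul_comm _ ((c : ℚ) ^ n)]
    exact_mod_cast this
  · have := card_monoOn_of_not_disjoint (κ := Fin c)
      (mt (disjoint_positions (schurSet_subset hp)).1 hd)
    simp only [Fintype.card_fin] at this
    rw [mul_comm _ ((c : ℚ) ^ n)]
    exact_mod_cast this

/-- The Schur triple `{x, y - x, y}` attached to a Schur triple `{x, y, x + y}` with `x < y`. -/
def schurParent (p : ℕ × ℕ) : ℕ × ℕ := (min p.1 (p.2 - p.1), max p.1 (p.2 - p.1))

lemma schurParent_mem {n : ℕ} {p : ℕ × ℕ} (hp : p ∈ schurPairs n) (h : p.1 < p.2) :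
    schurParent p ∈ schurPairs n := by
  rw [mem_schurPairs] at hp ⊢
  simp only [schurParent]
  omega

lemma schurParent_ne {n : ℕ} {p : ℕ × ℕ} (hp : p ∈ schurPairs n) (h : p.1 < p.2) :
    schurParent p ≠ p := by
  rw [mem_schurPairs] at hp
  simp only [schurParent, Ne, Prod.ext_iff]
  omega

lemma card_inter_schurSet_le_one {n : ℕ} {p q : ℕ × ℕ} (hp : p ∈ schurPairs n)
    (hq : q ∈ schurPairs n) (hpq : p ≠ q) (h₁ : ¬ (p.1 < p.2 ∧ schurParent p = q))
    (h₂ : ¬ (q.1 < q.2 ∧ schurParent q = p)) : (schurSet p ∩ schurSet q).card ≤ 1 := by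
  by_contra! h
  obtain ⟨a, ha, b, hb, hab⟩ := one_lt_card.1 h
  wlog hlt : a < b generalizing a b
  · exact this b hb a ha hab.symm (by omega)
  rw [mem_inter, mem_schurSet, mem_schurSet] at ha hb
  rw [mem_schurPairs] at hp hq
  obtain ⟨x, y⟩ := p
  obtain ⟨u, v⟩ := q
  simp only [schurParent, ne_eq, Prod.mk.injEq] at *
  obtain ⟨ha1, ha2⟩ := ha
  obtain ⟨hb1, hb2⟩ := hb
  rcases ha1 with ha1 | ha1 | ha1 <;> rcases hb1 with hb1 | hb1 | hb1 <;>
  rcases ha2 with ha2 | ha2 | ha2 <;> rcases hb2 with hb2 | hb2 | hb2 <;> omega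

lemma card_union_schurParent {n : ℕ} {p : ℕ × ℕ} (hp : p ∈ schurPairs n) (h : p.1 < p.2) :
    (schurSet p ∪ schurSet (schurParent p)).card = if p.2 = 2 * p.1 then 3 else 4 := by
  have hp' := mem_schurPairs.1 hp
  split_ifs with h2
  · have : schurSet p ∪ schurSet (schurParent p) = schurSet p := by
      refine union_eq_left.2 fun a ha => ?_
      simp only [mem_schurSet, schurParent] at ha ⊢
      omega
    rw [this, card_schurSet hp, if_neg h.ne]
  · have : schurSet p ∪ schurSet (schurParent p) = insert (p.2 - p.1) (schurSet p) := by
      ext a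
      simp only [mem_insert, mem_union, mem_schurSet, schurParent]
      omega
    rw [this, card_insert_of_notMem (by rw [mem_schurSet]; omega), card_schurSet hp,
      if_neg h.ne]

/-- The probability that a random coloring with `c` colors is constant on the triple of `p`. -/
def tripleProb (c : ℚ) (p : ℕ × ℕ) : ℚ := if p.1 = p.2 then 1 / c else 1 / c ^ 2

/-- The covariance of the indicators of a nondegenerate Schur triple and its parent. -/
def parentCov (c : ℚ) (p : ℕ × ℕ) : ℚ :=
  if p.2 = 2 * p.1 then 1 / c ^ 2 - 1 / c ^ 3 else 1 / c ^ 3 - 1 / c ^ 4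

lemma not_disjoint_schurParent (p : ℕ × ℕ) :
    ¬ Disjoint (schurSet p) (schurSet (schurParent p)) := by
  refine not_disjoint_iff.2 ⟨p.1, mem_schurSet.2 (Or.inl rfl), ?_⟩
  simp only [mem_schurSet, schurParent]
  omega

lemma monoProb_parent {n : ℕ} {c : ℚ} (hc : c ≠ 0) {p : ℕ × ℕ} (hp : p ∈ schurPairs n)
    (h : p.1 < p.2) : monoProb c (schurSet p) (schurSet (schurParent p)) =
      tripleProb c p * tripleProb c (schurParent p) + parentCov c p := by
  have e : (schurParent p).1 = (schurParent p).2 ↔ p.2 = 2 * p.1 := by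
    simp only [schurParent]; omega
  rw [monoProb, if_neg (not_disjoint_schurParent p), card_union_schurParent hp h]
  simp only [tripleProb, parentCov, e, if_neg h.ne]
  split_ifs <;> field_simp <;> ring

lemma monoProb_comm (c : ℚ) (A B : Finset ℕ) : monoProb c A B = monoProb c B A := by
  simp only [monoProb, disjoint_comm, union_comm]

lemma monoProb_eq {n : ℕ} {c : ℚ} (hc : c ≠ 0) {p q : ℕ × ℕ} (hp : p ∈ schurPairs n)
    (hq : q ∈ schurPairs n) : monoProb c (schurSet p) (schurSet q) =
      tripleProb c p * tripleProb c q + (if p = q then tripleProb c p - tripleProb c p ^ 2 else 0)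
        + (if schurParent p = q then (if p.1 < p.2 then parentCov c p else 0) else 0)
        + (if schurParent q = p then (if q.1 < q.2 then parentCov c q else 0) else 0) := by
  by_cases hpq : p = q
  · subst hpq
    have h0 : ¬ (schurParent p = p ∧ p.1 < p.2) := fun h => schurParent_ne hp h.2 h.1
    have hd : ¬ Disjoint (schurSet p) (schurSet p) := by
      simp [schurSet]
    rw [← ite_and, if_neg h0, if_pos rfl, monoProb, if_neg hd, union_self, card_schurSet hp,
      tripleProb]
    split_ifs <;> field_simp <;> ring
  by_cases h1 : p.1 < p.2 ∧ schurParent p = q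
  · obtain ⟨hlt, rfl⟩ := h1
    have h0 : ¬ (schurParent (schurParent p) = p ∧ (schurParent p).1 < (schurParent p).2) := by
      have := mem_schurPairs.1 hp
      simp only [schurParent, Prod.ext_iff]
      omega
    rw [← ite_and (schurParent (schurParent p) = p), if_neg h0, if_neg hpq, if_pos rfl,
      if_pos hlt, monoProb_parent hc hp hlt]
    ring
  by_cases h2 : q.1 < q.2 ∧ schurParent q = p
  · obtain ⟨hlt, rfl⟩ := h2
    rw [← ite_and (schurParent (schurParent q) = q), if_neg (mt And.symm h1), if_neg hpq,
      if_pos rfl, if_pos hlt, monoProb_comm, monoProb_parent hc hq hlt]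
    ring
  rw [← ite_and, ← ite_and, if_neg (mt And.symm h1), if_neg (mt And.symm h2), if_neg hpq]
  have hle := card_inter_schurSet_le_one hp hq hpq h1 h2
  have hadd := card_union_add_card_inter (schurSet p) (schurSet q)
  have hprod : tripleProb c p * tripleProb c q =
      c ^ 2 / c ^ ((schurSet p).card + (schurSet q).card) := by
    rw [card_schurSet hp, card_schurSet hq, tripleProb, tripleProb]
    split_ifs <;> field_simp
  rw [hprod, ← hadd, monoProb]
  split_ifs with hd
  · rw [disjoint_iff_inter_eq_empty.1 hd]
    simp
  · have : (schurSet p ∩ schurSet q).card = 1 := by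
      have : 0 < (schurSet p ∩ schurSet q).card := by
        rw [card_pos, nonempty_iff_ne_empty]
        exact fun h => hd (disjoint_iff_inter_eq_empty.2 h)
      omega
    rw [this, pow_succ]
    field_simp
    ring

lemma card_schurPairs_diag (m : ℕ) :
    ((schurPairs (2 * m + 1)).filter fun p => p.1 = p.2).card = m := by
  refine Eq.trans ?_ (Nat.card_Icc 1 m)
  refine (card_bij (fun a _ => (a, a)) ?_ ?_ ?_).symm
  · intro a ha
    simp only [mem_filter, mem_schurPairs, mem_Icc, and_true] at ha ⊢
    omega
  · intro a _ b _ h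
    exact (Prod.ext_iff.1 h).1
  · rintro ⟨x, y⟩ h
    simp only [mem_filter, mem_schurPairs] at h
    refine ⟨x, ?_, ?_⟩
    · rw [mem_Icc]; omega
    · rw [Prod.mk.injEq]; omega

lemma card_schurPairs_double (n : ℕ) :
    ((schurPairs n).filter fun p => p.2 = 2 * p.1).card = n / 3 := by
  refine Eq.trans ?_ (Nat.card_Icc 1 (n / 3))
  refine (card_bij (fun a _ => (a, 2 * a)) ?_ ?_ ?_).symm
  · intro a ha
    simp only [mem_filter, mem_schurPairs, mem_Icc, and_true] at ha ⊢
    omega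
  · intro a _ b _ h
    exact (Prod.ext_iff.1 h).1
  · rintro ⟨x, y⟩ h
    simp only [mem_filter, mem_schurPairs] at h
    refine ⟨x, ?_, ?_⟩
    · rw [mem_Icc]; omega
    · rw [Prod.mk.injEq]; omega

lemma card_schurPairs_lt (m : ℕ) :
    ((schurPairs (2 * m + 1)).filter fun p => p.1 < p.2).card = m ^ 2 := by
  induction m with
  | zero =>
    rw [zero_pow two_ne_zero, card_eq_zero, filter_eq_empty_iff]
    intro p hp
    rw [mem_schurPairs] at hp
    omega
  | succ k ih =>
    have h : ((schurPairs (2 * (k + 1) + 1)).filter fun p => p.1 < p.2) =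
        ((schurPairs (2 * k + 1)).filter fun p => p.1 < p.2) ∪
          ((Icc 1 k).image (fun a => (a, 2 * k + 2 - a)) ∪
            (Icc 1 (k + 1)).image fun a => (a, 2 * k + 3 - a)) := by
      ext ⟨x, y⟩
      simp only [mem_filter, mem_schurPairs, mem_union, mem_image, mem_Icc, Prod.mk.injEq]
      constructor
      · intro h
        by_cases h1 : x + y ≤ 2 * k + 1
        · left; omega
        · right
          by_cases h2 : x + y = 2 * k + 2
          · exact Or.inl ⟨x, by omega, rfl, by omega⟩
          · exact Or.inr ⟨x, by omega, rfl, by omega⟩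
      · rintro (h | ⟨a, h⟩ | ⟨a, h⟩) <;> omega
    have inj : ∀ f : ℕ → ℕ, Function.Injective fun a => (a, f a) :=
      fun f a b h => (Prod.ext_iff.1 h).1
    rw [h, card_union_of_disjoint, card_union_of_disjoint, ih, card_image_of_injective _ (inj _),
      card_image_of_injective _ (inj _), Nat.card_Icc, Nat.card_Icc]
    · simp only [Nat.add_sub_cancel]; ring
    · rw [disjoint_left]
      rintro ⟨x, y⟩ h1 h2
      simp only [mem_image, mem_Icc, Prod.mk.injEq] at h1 h2
      obtain ⟨a, h1⟩ := h1
      obtain ⟨b, h2⟩ := h2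
      omega
    · rw [disjoint_left]
      rintro ⟨x, y⟩ h1 h2
      simp only [mem_filter, mem_schurPairs, mem_union, mem_image, mem_Icc, Prod.mk.injEq] at h1 h2
      rcases h2 with ⟨a, h2⟩ | ⟨a, h2⟩ <;> omega

lemma sum_split_diag (n : ℕ) (a b : ℚ) :
    ∑ p ∈ schurPairs n, (if p.1 = p.2 then a else b) =
      ((schurPairs n).filter fun p => p.1 = p.2).card * a +
        ((schurPairs n).filter fun p => p.1 < p.2).card * b := by
  have h : ((schurPairs n).filter fun p => ¬ p.1 = p.2) =
      (schurPairs n).filter fun p => p.1 < p.2 := by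
    refine filter_congr fun p hp => ?_
    rw [mem_schurPairs] at hp
    omega
  rw [sum_ite, h]
  simp

lemma sum_parentCov (n : ℕ) (c : ℚ) :
    ∑ p ∈ schurPairs n, (if p.1 < p.2 then parentCov c p else 0) =
      ((schurPairs n).filter fun p => p.2 = 2 * p.1).card *
          ((1 / c ^ 2 - 1 / c ^ 3) - (1 / c ^ 3 - 1 / c ^ 4)) +
        ((schurPairs n).filter fun p => p.1 < p.2).card * (1 / c ^ 3 - 1 / c ^ 4) := by
  have h : ∀ p ∈ schurPairs n, (if p.1 < p.2 then parentCov c p else 0) =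
      (if p.2 = 2 * p.1 then (1 / c ^ 2 - 1 / c ^ 3) - (1 / c ^ 3 - 1 / c ^ 4) else 0) +
        if p.1 < p.2 then 1 / c ^ 3 - 1 / c ^ 4 else 0 := by
    intro p hp
    rw [mem_schurPairs] at hp
    unfold parentCov
    split_ifs <;> first | omega | ring
  rw [sum_congr rfl h, sum_add_distrib, ← sum_filter, ← sum_filter]
  simp only [sum_const, nsmul_eq_mul]

lemma sum_monoProb (n : ℕ) {c : ℚ} (hc : c ≠ 0) :
    ∑ p ∈ schurPairs n, ∑ q ∈ schurPairs n, monoProb c (schurSet p) (schurSet q) =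
      (∑ p ∈ schurPairs n, tripleProb c p) ^ 2 +
        ∑ p ∈ schurPairs n, (tripleProb c p - tripleProb c p ^ 2) +
        2 * ∑ p ∈ schurPairs n, (if p.1 < p.2 then parentCov c p else 0) := by
  have hpar : ∀ p ∈ schurPairs n, ∑ q ∈ schurPairs n,
      (if schurParent p = q then (if p.1 < p.2 then parentCov c p else 0) else 0) =
        if p.1 < p.2 then parentCov c p else 0 := by
    intro p hp
    rw [sum_ite_eq]
    by_cases h : p.1 < p.2
    · rw [if_pos (schurParent_mem hp h)]
    · simp [h]
  rw [sum_congr rfl fun p hp => sum_congr rfl fun q hq => monoProb_eq hc hp hq]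
  simp only [sum_add_distrib]
  rw [sum_comm (f := fun p q =>
    if schurParent q = p then (if q.1 < q.2 then parentCov c q else 0) else 0),
    sum_congr rfl hpar, sq, sum_mul_sum]
  have hdiag : ∑ p ∈ schurPairs n, ∑ q ∈ schurPairs n,
      (if p = q then tripleProb c p - tripleProb c p ^ 2 else 0) =
        ∑ p ∈ schurPairs n, (tripleProb c p - tripleProb c p ^ 2) :=
    sum_congr rfl fun p hp => by rw [sum_ite_eq, if_pos hp]
  rw [hdiag]
  ring

/-- For `n ≥ 1` with `n ≡ 1 (mod 12)` and `c ≥ 1`, the second moment of the number of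
monochromatic Schur triples over a uniformly random `c`-coloring of `{1,…,n}` is
`(n−1)(24c³ − 76c − 27n + 65 − 9n² + 12cn² + 24c²n + 3n³ − 16c²)/(48c⁴)`. -/
theorem schur_second_moment_mod12 (n c : ℕ) (hn : 1 ≤ n) (hmod : n % 12 = 1) (hc : 1 ≤ c) :
    (∑ χ : Fin n → Fin c, (schurCount n c χ : ℚ) ^ 2) / (c : ℚ) ^ n =
      ((n : ℚ) - 1) * (24 * (c : ℚ) ^ 3 - 76 * c - 27 * n + 65 - 9 * (n : ℚ) ^ 2
          + 12 * c * (n : ℚ) ^ 2 + 24 * (c : ℚ) ^ 2 * n + 3 * (n : ℚ) ^ 3 - 16 * (c : ℚ) ^ 2)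
        / (48 * (c : ℚ) ^ 4) := by
  have hc0 : (c : ℚ) ≠ 0 := by positivity
  obtain ⟨k, rfl⟩ : ∃ k, n = 2 * (6 * k) + 1 := ⟨n / 12, by omega⟩
  have hcov : ∀ p : ℕ × ℕ, tripleProb c p - tripleProb c p ^ 2 =
      if p.1 = p.2 then 1 / (c : ℚ) - 1 / (c : ℚ) ^ 2 else 1 / (c : ℚ) ^ 2 - 1 / (c : ℚ) ^ 4 := by
    intro p
    unfold tripleProb
    split_ifs <;> ring
  rw [sum_sq_schurCount _ _ hc, sum_monoProb _ hc0, sum_parentCov]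
  simp only [hcov]
  simp only [tripleProb, sum_split_diag, card_schurPairs_diag, card_schurPairs_lt,
    card_schurPairs_double, show (2 * (6 * k) + 1) / 3 = 4 * k by omega]
  push_cast
  field_simp
  ring
end

section
/- For every integer r ≥ 1, the even binomial moments of the inversion number satisfy lim_{n→∞} B_{2r}(n) · r! · 72^r / n^{3r} = 1; that is, B_{2r}(n) = n^{3r}/(r! · 2^{3r} · 3^{2r}) plus lower order terms in n. -/
open Finset Filter

/-- The inversion number of a permutation of `Fin n`: the number of pairs `(i, j)` with
`i < j` and `π i > π j`. -/
def invNum {n : ℕ} (π : Equiv.Perm (Fin n)) : ℕ :=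
  ((univ : Finset (Fin n × Fin n)).filter (fun p => p.1 < p.2 ∧ π p.2 < π p.1)).card

/-- The `s`-th binomial moment of the centralized inversion number over `S_n`:
`B_s(n) = (1/n!) Σ_{π ∈ S_n} (1/s!) ∏_{j=0}^{s−1} (inv(π) − n(n−1)/4 − j)`. -/
noncomputable def invBinomMoment (s n : ℕ) : ℝ :=
  (1 / (n.factorial : ℝ)) * ∑ π : Equiv.Perm (Fin n),
    (1 / (s.factorial : ℝ)) * ∏ j ∈ Finset.range s,
      ((invNum π : ℝ) - (n : ℝ) * ((n : ℝ) - 1) / 4 - (j : ℝ))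

/-- The permutation of `Fin (n + 1)` sending `0` to `p` and whose remaining values are arranged
in the same relative order as those of `σ`. -/
def insertPerm {n : ℕ} (p : Fin (n + 1)) (σ : Equiv.Perm (Fin n)) : Equiv.Perm (Fin (n + 1)) :=
  (finSuccEquiv' 0).trans ((Equiv.optionCongr σ).trans (finSuccEquiv' p).symm)

lemma insertPerm_zero {n : ℕ} (p : Fin (n + 1)) (σ : Equiv.Perm (Fin n)) :
    insertPerm p σ 0 = p := by
  simp [insertPerm]

lemma insertPerm_succ {n : ℕ} (p : Fin (n + 1)) (σ : Equiv.Perm (Fin n)) (i : Fin n) :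
    insertPerm p σ i.succ = p.succAbove (σ i) := by
  have h : finSuccEquiv' (0 : Fin (n + 1)) i.succ = some i := by
    rw [← Fin.succAbove_zero_apply, finSuccEquiv'_succAbove]
  simp [insertPerm, h]

lemma insertPerm_bijective (n : ℕ) :
    Function.Bijective
      (fun x : Fin (n + 1) × Equiv.Perm (Fin n) => insertPerm x.1 x.2) := by
  rw [Fintype.bijective_iff_injective_and_card]
  constructor
  · rintro ⟨p, σ⟩ ⟨q, τ⟩ h
    have h0 := DFunLike.congr_fun h 0
    simp only [insertPerm_zero] at h0
    subst h0
    refine Prod.ext rfl (Equiv.ext fun i => ?_)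
    have hi := DFunLike.congr_fun h i.succ
    simp only [insertPerm_succ] at hi
    exact Fin.succAbove_right_injective hi
  · simp [Fintype.card_perm, Nat.factorial_succ]

lemma invNum_eq_sum {n : ℕ} (π : Equiv.Perm (Fin n)) :
    invNum π = ∑ i, ∑ j, if i < j ∧ π j < π i then 1 else 0 := by
  rw [invNum, Finset.card_filter, Fintype.sum_prod_type]

lemma invNum_insertPerm {n : ℕ} (p : Fin (n + 1)) (σ : Equiv.Perm (Fin n)) :
    invNum (insertPerm p σ) = invNum σ + p := by
  have h : (∑ j : Fin n, if p.succAbove (σ j) < p then 1 else 0) = (p : ℕ) := by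
    rw [Equiv.sum_comp σ (fun j => if p.succAbove j < p then 1 else 0)]
    simp only [Fin.succAbove_lt_iff_castSucc_lt]
    rw [← Finset.card_filter]
    have := Fin.sum_univ_castSucc (fun j : Fin (n + 1) => if j < p then 1 else 0)
    rw [if_neg (not_lt.mpr (Fin.le_last p)), add_zero, ← Finset.card_filter,
      ← Finset.card_filter] at this
    rw [← this, Finset.filter_gt_eq_Iio, Fin.card_Iio]
  rw [invNum_eq_sum, Fin.sum_univ_succ, invNum_eq_sum, add_comm]
  congr 1
  · refine Finset.sum_congr rfl fun i _ => ?_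
    rw [Fin.sum_univ_succ]
    simp [insertPerm_succ, Fin.succAbove_lt_succAbove_iff]
  · rw [Fin.sum_univ_succ]
    simpa [insertPerm_zero, insertPerm_succ] using h

/-- The expectation of `f` at the centralized inversion number over `S_n`. -/
noncomputable def invExp (n : ℕ) (f : ℝ → ℝ) : ℝ :=
  (1 / (n.factorial : ℝ)) * ∑ π : Equiv.Perm (Fin n),
    f ((invNum π : ℝ) - (n : ℝ) * ((n : ℝ) - 1) / 4)

lemma invExp_zero (f : ℝ → ℝ) : invExp 0 f = f 0 := by
  simp [invExp, invNum]

lemma invExp_const_mul (n : ℕ) (c : ℝ) (f : ℝ → ℝ) :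
    invExp n (fun x => c * f x) = c * invExp n f := by
  simp only [invExp, ← Finset.mul_sum]
  ring

lemma invExp_sum {ι : Type*} (n : ℕ) (s : Finset ι) (f : ι → ℝ → ℝ) :
    invExp n (fun x => ∑ i ∈ s, f i x) = ∑ i ∈ s, invExp n (f i) := by
  simp only [invExp, ← Finset.mul_sum]
  rw [Finset.sum_comm]

lemma invExp_one (n : ℕ) : invExp n (fun _ => 1) = 1 := by
  simp [invExp, Fintype.card_perm, Nat.factorial_ne_zero]

lemma invExp_succ (n : ℕ) (f : ℝ → ℝ) :
    invExp (n + 1) f = (1 / ((n : ℝ) + 1)) *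
      ∑ k ∈ Finset.range (n + 1), invExp n (fun x => f (((k : ℝ) - n / 2) + x)) := by
  simp only [invExp, ← Finset.mul_sum]
  rw [← (insertPerm_bijective n).sum_comp, Fintype.sum_prod_type,
    Finset.sum_range (fun k => ∑ π : Equiv.Perm (Fin n),
      f (((k : ℝ) - n / 2) + ((invNum π : ℝ) - (n : ℝ) * ((n : ℝ) - 1) / 4))), ← mul_assoc]
  congr 1
  · rw [Nat.factorial_succ]
    push_cast
    rw [one_div_mul_one_div]
  · refine Finset.sum_congr rfl fun p _ => Finset.sum_congr rfl fun σ _ => ?_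
    rw [invNum_insertPerm]
    push_cast
    congr 1
    ring

lemma invExp_comp_neg (n : ℕ) (f : ℝ → ℝ) : invExp n (fun x => f (-x)) = invExp n f := by
  induction n generalizing f with
  | zero => simp [invExp_zero]
  | succ n ih =>
    rw [invExp_succ, invExp_succ, ← Finset.sum_range_reflect]
    congr 1
    refine Finset.sum_congr rfl fun k hk => ?_
    rw [← ih]
    have hk' : k ≤ n := Nat.lt_succ_iff.mp (Finset.mem_range.mp hk)
    congr 1
    ext x
    rw [show n + 1 - 1 - k = n - k by omega, Nat.cast_sub hk']
    congr 1
    ring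

lemma invExp_pow_of_odd (n : ℕ) {s : ℕ} (hs : Odd s) : invExp n (fun x => x ^ s) = 0 := by
  have h := invExp_comp_neg n (fun x => x ^ s)
  have h' := invExp_const_mul n (-1) (fun x => x ^ s)
  simp only [hs.neg_pow, neg_one_mul] at h h'
  linarith

/-- The `j`-th central moment of the uniform distribution on `{0, …, n}`. -/
noncomputable def unifMoment (j n : ℕ) : ℝ :=
  (1 / ((n : ℝ) + 1)) * ∑ k ∈ Finset.range (n + 1), ((k : ℝ) - n / 2) ^ j

lemma unifMoment_zero (n : ℕ) : unifMoment 0 n = 1 := by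
  have : (n : ℝ) + 1 ≠ 0 := by positivity
  simp [unifMoment, this]

lemma unifMoment_two (n : ℕ) : unifMoment 2 n = (n : ℝ) * (n + 2) / 12 := by
  have h (c : ℝ) (m : ℕ) : ∑ k ∈ Finset.range m, ((k : ℝ) - c) ^ 2 =
      (m : ℝ) * (m - 1) * (2 * m - 1) / 6 - c * m * (m - 1) + m * c ^ 2 := by
    induction m with
    | zero => simp
    | succ m ih => rw [Finset.sum_range_succ, ih]; push_cast; ring
  have hn : (n : ℝ) + 1 ≠ 0 := by positivity
  rw [unifMoment, h]
  push_cast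
  field_simp
  ring

lemma abs_unifMoment_le (j n : ℕ) : |unifMoment j n| ≤ (n : ℝ) ^ j := by
  have hn : (0 : ℝ) < (n : ℝ) + 1 := by positivity
  rw [unifMoment, abs_mul, abs_of_pos (by positivity : 0 < 1 / ((n : ℝ) + 1)), one_div,
    inv_mul_le_iff₀ hn]
  calc |∑ k ∈ Finset.range (n + 1), ((k : ℝ) - n / 2) ^ j|
      ≤ ∑ k ∈ Finset.range (n + 1), |((k : ℝ) - n / 2) ^ j| := Finset.abs_sum_le_sum_abs _ _
    _ ≤ ∑ _k ∈ Finset.range (n + 1), (n : ℝ) ^ j := by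
        refine Finset.sum_le_sum fun k hk => ?_
        have hk' : (k : ℝ) ≤ n := by
          exact_mod_cast Nat.lt_succ_iff.mp (Finset.mem_range.mp hk)
        have hk0 : (0 : ℝ) ≤ k := Nat.cast_nonneg k
        rw [abs_pow]
        refine pow_le_pow_left₀ (abs_nonneg _) ?_ j
        rw [abs_le]
        constructor <;> linarith
    _ = ((n : ℝ) + 1) * (n : ℝ) ^ j := by simp

lemma invExp_pow_succ (s n : ℕ) :
    invExp (n + 1) (fun x => x ^ s) = ∑ j ∈ Finset.range (s + 1),
      (s.choose j : ℝ) * unifMoment j n * invExp n (fun x => x ^ (s - j)) := by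
  have h (k : ℕ) : invExp n (fun x => (((k : ℝ) - n / 2) + x) ^ s) =
      ∑ j ∈ Finset.range (s + 1), ((s.choose j : ℝ) * ((k : ℝ) - n / 2) ^ j) *
        invExp n (fun x => x ^ (s - j)) := by
    simp only [← invExp_const_mul, ← invExp_sum]
    congr 1
    ext x
    rw [add_pow]
    exact Finset.sum_congr rfl fun j _ => by ring
  rw [invExp_succ]
  simp only [h]
  rw [Finset.sum_comm, Finset.mul_sum]
  refine Finset.sum_congr rfl fun j _ => ?_
  rw [unifMoment, ← Finset.sum_mul, ← Finset.mul_sum]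
  ring

lemma tendsto_add_one_div_self :
    Tendsto (fun n : ℕ => ((n : ℝ) + 1) / n) atTop (nhds 1) := by
  have h : Tendsto (fun n : ℕ => 1 + 1 / (n : ℝ)) atTop (nhds (1 + 0)) :=
    tendsto_const_nhds.add tendsto_one_div_atTop_nhds_zero_nat
  rw [add_zero] at h
  refine h.congr' ?_
  filter_upwards [eventually_gt_atTop 0] with n hn
  have : (n : ℝ) ≠ 0 := by positivity
  field_simp

lemma tendsto_pow_succ_sub_pow_div (k : ℕ) :
    Tendsto (fun n : ℕ => (((n : ℝ) + 1) ^ (k + 1) - (n : ℝ) ^ (k + 1)) / (n : ℝ) ^ k)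
      atTop (nhds ((k : ℝ) + 1)) := by
  induction k with
  | zero => simp
  | succ k ih =>
    have h := (tendsto_add_one_div_self.mul ih).add_const 1
    rw [one_mul] at h
    push_cast
    refine h.congr' ?_
    filter_upwards [eventually_gt_atTop 0] with n hn
    have : (n : ℝ) ≠ 0 := by positivity
    field_simp
    ring

/-- Stolz–Cesàro against powers of `n`. -/
lemma tendsto_div_pow_of_tendsto_sub_div_pow {a : ℕ → ℝ} {L : ℝ} (k : ℕ)
    (h : Tendsto (fun n : ℕ => (a (n + 1) - a n) / (n : ℝ) ^ k) atTop (nhds L)) :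
    Tendsto (fun n : ℕ => a n / (n : ℝ) ^ (k + 1)) atTop (nhds (L / (k + 1))) := by
  set l := L / ((k : ℝ) + 1) with hl
  set g : ℕ → ℝ := fun n => ((n : ℝ) + 1) ^ (k + 1) - (n : ℝ) ^ (k + 1) with hg
  have hgpos (n : ℕ) : 0 < g n :=
    sub_pos.mpr (pow_lt_pow_left₀ (by linarith) (Nat.cast_nonneg n) k.succ_ne_zero)
  have hgsum (n : ℕ) : ∑ i ∈ Finset.range n, g i = (n : ℝ) ^ (k + 1) := by
    have := Finset.sum_range_sub (fun i : ℕ => (i : ℝ) ^ (k + 1)) n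
    simpa [hg] using this
  have hasum (n : ℕ) : ∑ i ∈ Finset.range n, (a (i + 1) - a i - l * g i) =
      a n - a 0 - l * (n : ℝ) ^ (k + 1) := by
    rw [Finset.sum_sub_distrib, Finset.sum_range_sub, ← Finset.mul_sum, hgsum]
  have hpow : Tendsto (fun n : ℕ => (n : ℝ) ^ (k + 1)) atTop atTop :=
    (tendsto_pow_atTop k.succ_ne_zero).comp tendsto_natCast_atTop_atTop
  have hlittle : (fun n => a (n + 1) - a n - l * g n) =o[atTop] g := by
    rw [Asymptotics.isLittleO_iff_tendsto' (Eventually.of_forall fun n h0 =>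
      absurd h0 (hgpos n).ne')]
    have h1 := (h.div (tendsto_pow_succ_sub_pow_div k) (by positivity)).sub_const l
    rw [← hl, sub_self] at h1
    refine h1.congr' ?_
    filter_upwards [eventually_gt_atTop 0] with n hn
    have h2 : (n : ℝ) ^ k ≠ 0 := by positivity
    have h3 := (hgpos n).ne'
    simp only [Pi.div_apply]
    rw [div_div_div_cancel_right₀ h2, sub_div _ (l * g n), mul_div_cancel_right₀ _ h3]
  have hsum := hlittle.sum_range (fun n => (hgpos n).le) (by simpa only [hgsum] using hpow)
  simp only [hasum, hgsum] at hsum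
  have h4 := hsum.tendsto_div_nhds_zero
  have h5 := (h4.add (hpow.const_div_atTop (a 0))).add_const l
  rw [add_zero, zero_add] at h5
  refine h5.congr' ?_
  filter_upwards [eventually_gt_atTop 0] with n hn
  have : (n : ℝ) ≠ 0 := by positivity
  field_simp
  ring

lemma tendsto_unifMoment_two : Tendsto (fun n : ℕ => unifMoment 2 n / (n : ℝ) ^ 2)
    atTop (nhds (1 / 12)) := by
  have h : Tendsto (fun n : ℕ => 1 / 12 + 1 / 6 * (1 / (n : ℝ))) atTop
      (nhds (1 / 12 + 1 / 6 * 0)) :=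
    tendsto_const_nhds.add (tendsto_one_div_atTop_nhds_zero_nat.const_mul _)
  rw [mul_zero, add_zero] at h
  refine h.congr' ?_
  filter_upwards [eventually_gt_atTop 0] with n hn
  have : (n : ℝ) ≠ 0 := by positivity
  rw [unifMoment_two]
  field_simp
  ring

lemma tendsto_unifMoment_div_pow {j k : ℕ} (hjk : j < k) :
    Tendsto (fun n : ℕ => unifMoment j n / (n : ℝ) ^ k) atTop (nhds 0) := by
  refine squeeze_zero_norm' ?_ tendsto_one_div_atTop_nhds_zero_nat
  filter_upwards [eventually_gt_atTop 0] with n hn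
  have hn1 : (1 : ℝ) ≤ n := by exact_mod_cast hn
  have hn0 : (0 : ℝ) < n := by linarith
  rw [Real.norm_eq_abs, abs_div, abs_of_pos (by positivity : 0 < (n : ℝ) ^ k),
    div_le_div_iff₀ (by positivity) hn0, one_mul]
  calc |unifMoment j n| * n ≤ (n : ℝ) ^ j * n := by gcongr; exact abs_unifMoment_le j n
    _ = (n : ℝ) ^ (j + 1) := (pow_succ _ _).symm
    _ ≤ (n : ℝ) ^ k := pow_le_pow_right₀ hn1 hjk

lemma tendsto_invExp_pow_even (r : ℕ) :
    Tendsto (fun n : ℕ => invExp n (fun x => x ^ (2 * r)) / (n : ℝ) ^ (3 * r)) atTop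
      (nhds (((2 * r).factorial : ℝ) / (r.factorial * 72 ^ r))) := by
  induction r using Nat.strong_induction_on with
  | _ r ih =>
  rcases r with _ | r
  · simp [invExp_one]
  set c : ℝ := ((2 * r).factorial : ℝ) / (r.factorial * 72 ^ r) with hc
  have hterm (j : ℕ) (hj : j ∈ Finset.range (2 * (r + 1))) :
      Tendsto (fun n : ℕ => ((2 * (r + 1)).choose (j + 1) : ℝ) * unifMoment (j + 1) n *
          invExp n (fun x => x ^ (2 * (r + 1) - (j + 1))) / (n : ℝ) ^ (3 * r + 2)) atTop
        (nhds (if j = 1 then ((2 * (r + 1)).choose 2 : ℝ) * (1 / 12) * c else 0)) := by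
    have hj' := Finset.mem_range.mp hj
    rcases Nat.even_or_odd' j with ⟨i, rfl | rfl⟩
    · have hodd : Odd (2 * (r + 1) - (2 * i + 1)) := ⟨r - i, by omega⟩
      simp [invExp_pow_of_odd _ hodd, show 2 * i ≠ 1 by omega]
    · have hi : i ≤ r := by omega
      have hsub : 2 * (r + 1) - (2 * i + 1 + 1) = 2 * (r - i) := by omega
      have hM := ih (r - i) (by omega)
      have hsplit : 3 * r + 2 = (3 * i + 2) + 3 * (r - i) := by omega
      simp only [hsub, hsplit, pow_add _ (3 * i + 2), mul_div_mul_comm]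
      simp only [mul_div_assoc]
      rcases Nat.eq_zero_or_pos i with rfl | hpos
      · simpa using (tendsto_unifMoment_two.const_mul _).mul hM
      · have hu : Tendsto (fun n : ℕ => unifMoment (2 * i + 1 + 1) n / (n : ℝ) ^ (3 * i + 2))
            atTop (nhds 0) := tendsto_unifMoment_div_pow (by omega)
        rw [if_neg (by omega)]
        simpa using (hu.const_mul _).mul hM
  have hinc : Tendsto (fun n : ℕ => (invExp (n + 1) (fun x => x ^ (2 * (r + 1))) -
      invExp n (fun x => x ^ (2 * (r + 1)))) / (n : ℝ) ^ (3 * r + 2)) atTop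
      (nhds (((2 * (r + 1)).choose 2 : ℝ) * (1 / 12) * c)) := by
    have h := tendsto_finsetSum _ hterm
    rw [Finset.sum_ite_eq', if_pos (Finset.mem_range.mpr (by omega))] at h
    refine h.congr fun n => ?_
    rw [invExp_pow_succ, Finset.sum_range_succ', ← Finset.sum_div]
    simp [unifMoment_zero]
  have hfin := tendsto_div_pow_of_tendsto_sub_div_pow
    (a := fun n => invExp n (fun x => x ^ (2 * (r + 1)))) (3 * r + 2) hinc
  rw [show 3 * (r + 1) = 3 * r + 2 + 1 by ring]
  convert hfin using 2
  rw [hc, Nat.cast_choose_two, show 2 * (r + 1) = 2 * r + 1 + 1 by ring]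
  simp only [Nat.factorial_succ]
  push_cast
  have : (r.factorial : ℝ) ≠ 0 := by positivity
  field_simp
  ring

lemma tendsto_invExp_pow_of_lt {i r : ℕ} (h : i < 2 * r) :
    Tendsto (fun n : ℕ => invExp n (fun x => x ^ i) / (n : ℝ) ^ (3 * r)) atTop (nhds 0) := by
  rcases Nat.even_or_odd' i with ⟨q, rfl | rfl⟩
  · have h1 : Tendsto (fun n : ℕ => ((n : ℝ) ^ (3 * (r - q)))⁻¹) atTop (nhds 0) :=
      tendsto_inv_atTop_zero.comp
        ((tendsto_pow_atTop (by omega)).comp tendsto_natCast_atTop_atTop)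
    have h2 := (tendsto_invExp_pow_even q).mul h1
    rw [mul_zero] at h2
    refine h2.congr fun n => ?_
    rw [show 3 * r = 3 * q + 3 * (r - q) by omega, pow_add, div_mul_eq_div_div, div_eq_mul_inv _
      ((n : ℝ) ^ (3 * (r - q)))]
  · simp [invExp_pow_of_odd _ (odd_two_mul_add_one q)]

lemma invBinomMoment_eq_sum (s n : ℕ) :
    invBinomMoment s n = (1 / (s.factorial : ℝ)) * (∑ i ∈ Finset.range s,
      (descPochhammer ℝ s).coeff i * invExp n (fun x => x ^ i) + invExp n (fun x => x ^ s)) := by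
  have hdeg : (descPochhammer ℝ s).natDegree = s := descPochhammer_natDegree ℝ s
  have hlead : (descPochhammer ℝ s).coeff s = 1 := by
    have := monic_descPochhammer ℝ s
    rwa [Polynomial.Monic, Polynomial.leadingCoeff, hdeg] at this
  have hexp : invBinomMoment s n =
      invExp n (fun x => (1 / (s.factorial : ℝ)) * (descPochhammer ℝ s).eval x) := by
    simp only [invBinomMoment, invExp, descPochhammer_eval_eq_prod_range]
  rw [hexp, invExp_const_mul]
  simp only [Polynomial.eval_eq_sum_range, hdeg]
  rw [invExp_sum, Finset.sum_range_succ]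
  simp only [invExp_const_mul, hlead, one_mul]

/-- For `r ≥ 1`, the even binomial moments of the inversion number satisfy
`lim_{n→∞} B_{2r}(n) · r! · 72^r / n^{3r} = 1`, i.e.
`B_{2r}(n) = n^{3r}/(r! · 2^{3r} · 3^{2r})` plus lower order terms. -/
theorem invBinomMoment_even_leading (r : ℕ) (hr : 1 ≤ r) :
    Tendsto (fun n : ℕ =>
        invBinomMoment (2 * r) n * (r.factorial : ℝ) * 72 ^ r / (n : ℝ) ^ (3 * r))
      atTop (nhds 1) := by
  have hlow : Tendsto (fun n : ℕ => ∑ i ∈ Finset.range (2 * r),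
      (descPochhammer ℝ (2 * r)).coeff i * (invExp n (fun x => x ^ i) / (n : ℝ) ^ (3 * r)))
      atTop (nhds 0) := by
    have h := tendsto_finsetSum (Finset.range (2 * r)) fun i hi =>
      (tendsto_invExp_pow_of_lt (Finset.mem_range.mp hi)).const_mul
        ((descPochhammer ℝ (2 * r)).coeff i)
    simpa using h
  have h := ((hlow.add (tendsto_invExp_pow_even r)).const_mul
    (1 / ((2 * r).factorial : ℝ))).mul_const ((r.factorial : ℝ) * 72 ^ r)
  have h1 : ((2 * r).factorial : ℝ) ≠ 0 := by positivity
  have h2 : (r.factorial : ℝ) ≠ 0 := by positivity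
  convert h using 2 with n
  · rw [invBinomMoment_eq_sum]
    simp only [← mul_div_assoc, ← Finset.sum_div]
    ring
  · field_simp
    ring
end

section
/- For every integer r ≥ 1, the normalized even central moments of the inversion number converge to the Gaussian moments: lim_{n→∞} [ (1/n!) Σ_{π ∈ S_n} (inv(π) − n(n−1)/4)^{2r} ] / (n(n−1)(2n+5)/72)^r = (2r)!/(2^r · r!). -/
open Finset Filter

/-- The permutation of `Fin (n + 1)` sending `0` to `k` and acting on the remaining points
as `e` does, after the order-preserving relabelling of the complement of `k`. -/
def permCons {n : ℕ} (k : Fin (n + 1)) (e : Equiv.Perm (Fin n)) : Equiv.Perm (Fin (n + 1)) :=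
  ((finSuccEquiv' 0).trans (Equiv.optionCongr e)).trans (finSuccEquiv' k).symm

lemma permCons_zero {n : ℕ} (k : Fin (n + 1)) (e : Equiv.Perm (Fin n)) :
    permCons k e 0 = k := by
  simp [permCons]

lemma permCons_succ {n : ℕ} (k : Fin (n + 1)) (e : Equiv.Perm (Fin n)) (i : Fin n) :
    permCons k e i.succ = k.succAbove (e i) := by
  have h : finSuccEquiv' (0 : Fin (n + 1)) i.succ = some i := by
    rw [← Fin.succAbove_zero_apply, finSuccEquiv'_succAbove]
  simp [permCons, h]

lemma permCons_bijective (n : ℕ) :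
    Function.Bijective
      (fun p : Fin (n + 1) × Equiv.Perm (Fin n) => permCons p.1 p.2) := by
  rw [Fintype.bijective_iff_injective_and_card]
  constructor
  · rintro ⟨k, e⟩ ⟨k', e'⟩ h
    have hk : k = k' := by
      simpa [permCons_zero] using congrArg (fun π : Equiv.Perm (Fin (n + 1)) => π 0) h
    subst hk
    congr 1
    ext i : 1
    have hi := congrArg (fun π : Equiv.Perm (Fin (n + 1)) => π i.succ) h
    simpa [permCons_succ] using hi
  · simp [Fintype.card_perm, Nat.factorial_succ]

lemma invNum_permCons {n : ℕ} (k : Fin (n + 1)) (e : Equiv.Perm (Fin n)) :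
    invNum (permCons k e) = k + invNum e := by
  have hrow : (∑ j : Fin n, if (e j).castSucc < k then 1 else 0) = (k : ℕ) := by
    rw [Equiv.sum_comp e (fun j : Fin n => if j.castSucc < k then 1 else 0)]
    simp only [Fin.lt_def, Fin.val_castSucc]
    rw [Fin.sum_univ_eq_sum_range (fun j => if j < (k : ℕ) then 1 else 0), ← card_filter]
    have : (range n).filter (fun j => j < (k : ℕ)) = range k := by
      ext j
      simp only [mem_filter, mem_range]
      omega
    rw [this, card_range]
  rw [invNum_eq_sum, invNum_eq_sum, Fin.sum_univ_succ]
  simp only [Fin.sum_univ_succ, permCons_zero, permCons_succ, Fin.succ_lt_succ_iff,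
    Fin.succAbove_lt_succAbove_iff, Fin.succAbove_lt_iff_castSucc_lt]
  simp [hrow]

/-- The `m`-th central moment of the inversion number on `S_n`. -/
noncomputable def invMoment (m n : ℕ) : ℝ :=
  (1 / (n.factorial : ℝ)) * ∑ π : Equiv.Perm (Fin n),
    ((invNum π : ℝ) - (n : ℝ) * ((n : ℝ) - 1) / 4) ^ m

/-- The `m`-th central moment of the uniform distribution on `{0, …, n}`. -/
noncomputable def uniformMoment (m n : ℕ) : ℝ :=
  (1 / ((n : ℝ) + 1)) * ∑ k ∈ range (n + 1), ((k : ℝ) - n / 2) ^ m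

lemma invMoment_succ (m n : ℕ) :
    invMoment m (n + 1) =
      ∑ j ∈ range (m + 1), (m.choose j : ℝ) * (invMoment j n * uniformMoment (m - j) n) := by
  have hsum : ∑ π : Equiv.Perm (Fin (n + 1)),
      ((invNum π : ℝ) - ((n + 1 : ℕ) : ℝ) * (((n + 1 : ℕ) : ℝ) - 1) / 4) ^ m =
      ∑ k ∈ range (n + 1), ∑ e : Equiv.Perm (Fin n), ∑ j ∈ range (m + 1),
        ((invNum e : ℝ) - (n : ℝ) * ((n : ℝ) - 1) / 4) ^ j * ((k : ℝ) - n / 2) ^ (m - j) *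
          (m.choose j : ℝ) := by
    rw [← (permCons_bijective n).sum_comp, Fintype.sum_prod_type,
      ← Fin.sum_univ_eq_sum_range (fun k => ∑ e : Equiv.Perm (Fin n), ∑ j ∈ range (m + 1),
        ((invNum e : ℝ) - (n : ℝ) * ((n : ℝ) - 1) / 4) ^ j * ((k : ℝ) - n / 2) ^ (m - j) *
          (m.choose j : ℝ))]
    refine sum_congr rfl fun k _ => sum_congr rfl fun e _ => ?_
    rw [← add_pow, invNum_permCons]
    congr 1
    push_cast
    ring
  rw [invMoment, hsum]
  simp_rw [invMoment, uniformMoment]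
  have hswap : ∀ F : ℕ → Equiv.Perm (Fin n) → ℕ → ℝ,
      ∑ k ∈ range (n + 1), ∑ e, ∑ j ∈ range (m + 1), F k e j =
        ∑ j ∈ range (m + 1), ∑ e, ∑ k ∈ range (n + 1), F k e j := by
    intro F
    rw [sum_comm]
    simp_rw [sum_comm (s := range (n + 1)) (t := range (m + 1))]
    rw [sum_comm]
  rw [hswap, mul_sum]
  refine sum_congr rfl fun j _ => ?_
  have hfac : (1 / ((n + 1).factorial : ℝ)) = 1 / (n.factorial : ℝ) * (1 / ((n : ℝ) + 1)) := by
    rw [Nat.factorial_succ]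
    push_cast
    rw [one_div_mul_one_div, mul_comm]
  simp_rw [← sum_mul, ← mul_sum]
  rw [← sum_mul, hfac]
  ring

lemma uniformMoment_zero (n : ℕ) : uniformMoment 0 n = 1 := by
  have : (n : ℝ) + 1 ≠ 0 := by positivity
  simp [uniformMoment, this]

lemma uniformMoment_two (n : ℕ) : uniformMoment 2 n = (n : ℝ) * (n + 2) / 12 := by
  have hsum : ∀ (N : ℕ) (a : ℝ), ∑ k ∈ range (N + 1), ((k : ℝ) - a) ^ 2 =
      (N : ℝ) * (N + 1) * (2 * N + 1) / 6 - a * N * (N + 1) + (N + 1) * a ^ 2 := by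
    intro N a
    induction N with
    | zero => simp
    | succ N ih =>
      rw [sum_range_succ, ih]
      push_cast
      ring
  have : (n : ℝ) + 1 ≠ 0 := by positivity
  rw [uniformMoment, hsum]
  field_simp
  ring

lemma uniformMoment_odd {m : ℕ} (hm : Odd m) (n : ℕ) : uniformMoment m n = 0 := by
  have h : ∑ k ∈ range (n + 1), ((k : ℝ) - n / 2) ^ m =
      -∑ k ∈ range (n + 1), ((k : ℝ) - n / 2) ^ m := by
    conv_lhs => rw [← sum_range_reflect]
    rw [← sum_neg_distrib]
    refine sum_congr rfl fun k hk => ?_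
    have hk' : k ≤ n := by simpa [Nat.lt_succ_iff] using hk
    rw [← hm.neg_pow]
    congr 1
    rw [show n + 1 - 1 - k = n - k by omega, Nat.cast_sub hk']
    ring
  rw [uniformMoment, self_eq_neg.mp h, mul_zero]

lemma abs_uniformMoment_le (m n : ℕ) : |uniformMoment m n| ≤ (n : ℝ) ^ m := by
  have hn : (0 : ℝ) < (n : ℝ) + 1 := by positivity
  rw [uniformMoment, abs_mul, abs_of_pos (one_div_pos.mpr hn), one_div, inv_mul_le_iff₀ hn]
  refine (abs_sum_le_sum_abs _ _).trans ?_
  have h : ∀ k ∈ range (n + 1), |((k : ℝ) - n / 2) ^ m| ≤ (n : ℝ) ^ m := by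
    intro k hk
    have hk' : (k : ℝ) ≤ n := by
      exact_mod_cast Nat.lt_succ_iff.mp (mem_range.mp hk)
    have hk0 : (0 : ℝ) ≤ k := k.cast_nonneg
    rw [abs_pow]
    gcongr
    rw [abs_le]
    constructor <;> linarith
  simpa using sum_le_sum h

lemma invMoment_zero_right {m : ℕ} (hm : m ≠ 0) : invMoment m 0 = 0 := by
  simp [invMoment, invNum, hm]

lemma invMoment_zero_left (n : ℕ) : invMoment 0 n = 1 := by
  have : (n.factorial : ℝ) ≠ 0 := by positivity
  simp [invMoment, Fintype.card_perm, this]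

lemma invMoment_odd {m : ℕ} (hm : Odd m) (n : ℕ) : invMoment m n = 0 := by
  induction n generalizing m with
  | zero => exact invMoment_zero_right hm.pos.ne'
  | succ n ih =>
    rw [invMoment_succ]
    refine sum_eq_zero fun j hj => ?_
    have hj' : j ≤ m := Nat.lt_succ_iff.mp (mem_range.mp hj)
    rcases Nat.even_or_odd j with h | h
    · rw [uniformMoment_odd (Nat.Odd.sub_even hj' hm h)]
      simp
    · rw [ih h]
      simp

/-- The **Stolz–Cesàro theorem**. -/
lemma tendsto_div_of_tendsto_sub_div_sub {a b : ℕ → ℝ} {L : ℝ}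
    (hb : ∀ n, b n < b (n + 1)) (hb_top : Tendsto b atTop atTop)
    (h : Tendsto (fun n => (a (n + 1) - a n) / (b (n + 1) - b n)) atTop (nhds L)) :
    Tendsto (fun n => a n / b n) atTop (nhds L) := by
  have hpos : ∀ n, 0 < b (n + 1) - b n := fun n => sub_pos.mpr (hb n)
  have hsum : ∀ n, ∑ i ∈ range n, (b (i + 1) - b i) = b n - b 0 := fun n => sum_range_sub b n
  have ho : (fun n => (a (n + 1) - a n) - L * (b (n + 1) - b n)) =o[atTop]
      (fun n => b (n + 1) - b n) := by
    rw [Asymptotics.isLittleO_iff_tendsto' (Eventually.of_forall fun n hn =>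
      absurd hn (hpos n).ne')]
    have h' := h.sub_const L
    rw [sub_self] at h'
    refine h'.congr fun n => ?_
    rw [sub_div _ (L * _), mul_div_cancel_right₀ _ (hpos n).ne']
  have hs := ho.sum_range (fun n => (hpos n).le) (by
    simp_rw [hsum]
    exact tendsto_atTop_add_const_right _ _ hb_top)
  have hsum' : ∀ n, ∑ i ∈ range n, ((a (i + 1) - a i) - L * (b (i + 1) - b i)) =
      (a n - a 0) - L * (b n - b 0) := fun n => by
    rw [sum_sub_distrib (fun i => a (i + 1) - a i), ← mul_sum, hsum, sum_range_sub a]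
  simp_rw [hsum, hsum'] at hs
  have hconst : ∀ c : ℝ, Tendsto (fun n => c / b n) atTop (nhds 0) := fun c =>
    hb_top.const_div_atTop c
  have hne : ∀ᶠ n in atTop, b n ≠ 0 := (hb_top.eventually_gt_atTop 0).mono fun n hn => hn.ne'
  have hO : (fun n => b n - b 0) =O[atTop] b := by
    refine (Asymptotics.isBigO_refl b atTop).sub ?_
    refine Asymptotics.IsLittleO.isBigO ?_
    rw [Asymptotics.isLittleO_iff_tendsto' (hne.mono fun n hn h0 => absurd h0 hn)]
    exact hconst _
  have ht := (hs.trans_isBigO hO).tendsto_div_nhds_zero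
  have ht' := (ht.add (hconst (a 0 - L * b 0))).add_const L
  rw [zero_add, zero_add] at ht'
  refine ht'.congr' ?_
  filter_upwards [hne] with n hn
  field_simp
  ring

lemma tendsto_natCast_add_div (c : ℝ) :
    Tendsto (fun n : ℕ => ((n : ℝ) + c) / n) atTop (nhds 1) := by
  have h := (tendsto_const_div_atTop_nhds_zero_nat c).const_add 1
  rw [add_zero] at h
  refine h.congr' ?_
  filter_upwards [eventually_ne_atTop 0] with n hn
  have : (n : ℝ) ≠ 0 := by exact_mod_cast hn
  field_simp

lemma tendsto_succ_pow_sub_pow_div (p : ℕ) :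
    Tendsto (fun n : ℕ => (((n : ℝ) + 1) ^ (p + 1) - (n : ℝ) ^ (p + 1)) / (n : ℝ) ^ p) atTop
      (nhds ((p : ℝ) + 1)) := by
  induction p with
  | zero => simp
  | succ p ih =>
    have h := ((tendsto_natCast_add_div 1).mul ih).add_const 1
    rw [one_mul] at h
    push_cast
    refine h.congr' ?_
    filter_upwards [eventually_ne_atTop 0] with n hn
    have : (n : ℝ) ≠ 0 := by exact_mod_cast hn
    field_simp
    ring

lemma tendsto_div_pow_succ_of_tendsto_sub_div_pow {a : ℕ → ℝ} {c : ℝ} (p : ℕ)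
    (h : Tendsto (fun n : ℕ => (a (n + 1) - a n) / (n : ℝ) ^ p) atTop (nhds c)) :
    Tendsto (fun n : ℕ => a n / (n : ℝ) ^ (p + 1)) atTop (nhds (c / ((p : ℝ) + 1))) := by
  refine tendsto_div_of_tendsto_sub_div_sub (b := fun n : ℕ => (n : ℝ) ^ (p + 1)) ?_ ?_ ?_
  · intro n
    have : (n : ℝ) < ((n + 1 : ℕ) : ℝ) := by exact_mod_cast n.lt_succ_self
    exact pow_lt_pow_left₀ this n.cast_nonneg p.succ_ne_zero
  · exact (tendsto_pow_atTop p.succ_ne_zero).comp tendsto_natCast_atTop_atTop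
  · refine (h.div (tendsto_succ_pow_sub_pow_div p) (by positivity)).congr' ?_
    filter_upwards [eventually_ne_atTop 0] with n hn
    have : (n : ℝ) ^ p ≠ 0 := pow_ne_zero _ (by exact_mod_cast hn)
    rw [Pi.div_apply, div_div_div_cancel_right₀ this]
    push_cast
    rfl

lemma tendsto_uniformMoment_two_div :
    Tendsto (fun n : ℕ => uniformMoment 2 n / (n : ℝ) ^ 2) atTop (nhds (1 / 12)) := by
  refine ((tendsto_natCast_add_div 2).div_const 12).congr' ?_
  filter_upwards [eventually_ne_atTop 0] with n hn
  have : (n : ℝ) ≠ 0 := by exact_mod_cast hn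
  rw [uniformMoment_two]
  field_simp

lemma tendsto_invMoment_mul_uniformMoment_zero {i m p : ℕ} {L : ℝ}
    (h : Tendsto (fun n : ℕ => invMoment (2 * i) n / (n : ℝ) ^ (3 * i)) atTop (nhds L))
    (hp : 3 * i + m < p) :
    Tendsto (fun n : ℕ => invMoment (2 * i) n * uniformMoment m n / (n : ℝ) ^ p)
      atTop (nhds 0) := by
  obtain ⟨d, rfl⟩ := Nat.exists_eq_add_of_lt hp
  have h0 : Tendsto (fun n : ℕ => ((n : ℝ) ^ (d + 1))⁻¹) atTop (nhds 0) :=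
    ((tendsto_pow_atTop d.succ_ne_zero).comp tendsto_natCast_atTop_atTop).inv_tendsto_atTop
  have h1 := (h.mul h0).abs
  rw [mul_zero, abs_zero] at h1
  refine squeeze_zero_norm' ?_ h1
  filter_upwards [eventually_ne_atTop 0] with n hn
  have hn' : (0 : ℝ) < n := by exact_mod_cast Nat.pos_of_ne_zero hn
  have hu := abs_uniformMoment_le m n
  have hM : |invMoment (2 * i) n| * |uniformMoment m n| ≤
      |invMoment (2 * i) n| * (n : ℝ) ^ m := by gcongr
  rw [Real.norm_eq_abs, abs_div, abs_mul, abs_mul, abs_div, abs_inv, abs_of_pos (pow_pos hn' _),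
    abs_of_pos (pow_pos hn' _), abs_of_pos (pow_pos hn' _), div_le_iff₀ (pow_pos hn' _)]
  refine hM.trans_eq ?_
  rw [show 3 * i + m + d + 1 = 3 * i + m + (d + 1) by ring, pow_add _ (3 * i + m),
    pow_add _ (3 * i)]
  field_simp

/-- The even central moments of the inversion number, on the scale `n ^ (3 * r)`. -/
lemma tendsto_invMoment_div_pow (r : ℕ) :
    Tendsto (fun n : ℕ => invMoment (2 * r) n / (n : ℝ) ^ (3 * r)) atTop
      (nhds (((2 * r).factorial : ℝ) / (2 ^ r * (r.factorial : ℝ)) / 36 ^ r)) := by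
  induction r using Nat.strong_induction_on with
  | _ r ih =>
  rcases r with _ | q
  · simp [invMoment_zero_left]
  set L : ℝ := ((2 * q).factorial : ℝ) / (2 ^ q * (q.factorial : ℝ)) / 36 ^ q with hL
  set c : ℝ := ((2 * q + 2).choose (2 * q) : ℝ) * (L * (1 / 12)) with hc
  have hterm : ∀ j ∈ range (2 * q + 2), Tendsto (fun n : ℕ => ((2 * q + 2).choose j : ℝ) *
      (invMoment j n * uniformMoment (2 * q + 2 - j) n / (n : ℝ) ^ (3 * q + 2))) atTop
      (nhds (if j = 2 * q then c else 0)) := by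
    intro j hj
    rw [mem_range] at hj
    rcases Nat.even_or_odd' j with ⟨i, rfl | rfl⟩
    · rcases (show i ≤ q by omega).eq_or_lt with rfl | hi
      · rw [if_pos rfl, hc]
        refine Tendsto.const_mul _ ?_
        rw [Nat.add_sub_cancel_left]
        refine ((ih i (by omega)).mul tendsto_uniformMoment_two_div).congr fun n => ?_
        rw [div_mul_div_comm, ← pow_add]
      · rw [if_neg (by omega)]
        have := (tendsto_invMoment_mul_uniformMoment_zero (m := 2 * q + 2 - 2 * i)
          (p := 3 * q + 2) (ih i (by omega)) (by omega)).const_mul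
          ((2 * q + 2).choose (2 * i) : ℝ)
        rwa [mul_zero] at this
    · rw [if_neg (by omega)]
      simp [invMoment_odd (odd_two_mul_add_one i)]
  have hsum := tendsto_finsetSum _ hterm
  rw [sum_ite_eq', if_pos (by simp)] at hsum
  have hdiff : Tendsto (fun n : ℕ => (invMoment (2 * (q + 1)) (n + 1) - invMoment (2 * (q + 1)) n)
      / (n : ℝ) ^ (3 * q + 2)) atTop (nhds c) := by
    refine hsum.congr fun n => ?_
    rw [invMoment_succ, sum_range_succ _ (2 * (q + 1)), Nat.sub_self, uniformMoment_zero, Nat.choose_self,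
      Nat.cast_one, one_mul, mul_one, add_sub_cancel_right, sum_div]
    exact sum_congr rfl fun j _ => (mul_div_assoc _ _ _).symm
  have hlim := tendsto_div_pow_succ_of_tendsto_sub_div_pow (3 * q + 2) hdiff
  have hval : ((2 * (q + 1)).factorial : ℝ) / (2 ^ (q + 1) * ((q + 1).factorial : ℝ)) /
      36 ^ (q + 1) = c / (((3 * q + 2 : ℕ) : ℝ) + 1) := by
    have hch : ((2 * q + 2).choose (2 * q) : ℝ) = (2 * q + 2) * (2 * q + 1) / 2 := by
      rw [Nat.choose_symm_add, Nat.cast_choose_two]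
      push_cast
      ring
    rw [hc, hL, hch, show 2 * (q + 1) = 2 * q + 1 + 1 by ring, Nat.factorial_succ,
      Nat.factorial_succ, Nat.factorial_succ]
    push_cast
    field_simp
    ring
  rw [hval]
  exact hlim

lemma tendsto_variance_div_pow :
    Tendsto (fun n : ℕ => ((n : ℝ) * ((n : ℝ) - 1) * (2 * (n : ℝ) + 5) / 72) / (n : ℝ) ^ 3) atTop
      (nhds (1 / 36)) := by
  have h := ((tendsto_natCast_add_div (-1)).mul (tendsto_natCast_add_div (5 / 2))).div_const 36
  rw [one_mul] at h
  refine h.congr' ?_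
  filter_upwards [eventually_ne_atTop 0] with n hn
  have : (n : ℝ) ≠ 0 := by exact_mod_cast hn
  field_simp
  ring

/-- For `r ≥ 1`, the normalized even central moments of the inversion number converge to the
Gaussian moments:
`lim_{n→∞} [ (1/n!) Σ_{π ∈ S_n} (inv(π) − n(n−1)/4)^{2r} ] / (n(n−1)(2n+5)/72)^r
  = (2r)!/(2^r · r!)`. -/
theorem inv_even_central_moments_gaussian (r : ℕ) (hr : 1 ≤ r) :
    Tendsto (fun n : ℕ =>
        ((1 / (n.factorial : ℝ)) * ∑ π : Equiv.Perm (Fin n),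
            ((invNum π : ℝ) - (n : ℝ) * ((n : ℝ) - 1) / 4) ^ (2 * r)) /
          ((n : ℝ) * ((n : ℝ) - 1) * (2 * (n : ℝ) + 5) / 72) ^ r)
      atTop (nhds (((2 * r).factorial : ℝ) / (2 ^ r * (r.factorial : ℝ)))) := by
  have h := (tendsto_invMoment_div_pow r).div (tendsto_variance_div_pow.pow r) (by positivity)
  rw [one_div, inv_pow, div_inv_eq_mul, div_mul_cancel₀ _ (by positivity)] at h
  refine h.congr' ?_
  filter_upwards [eventually_ne_atTop 0] with n hn
  have hn' : (n : ℝ) ^ (3 * r) ≠ 0 := pow_ne_zero _ (by exact_mod_cast hn)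
  rw [Pi.div_apply, div_pow _ ((n : ℝ) ^ 3), ← pow_mul, div_div_div_cancel_right₀ hn', invMoment]
end

section
/- Let n ≥ 2. The polynomials F(n,i) satisfy the recurrences: (a) for every 1 ≤ i ≤ n−1, F(n,i)(q) − F(n,i+1)(q) = −(1 − q^{n−1}) · F(n−1,i)(q); and (b) F(n,n)(q) = Σ_{j=1}^{n−1} F(n−1,j)(q). -/
open Finset Polynomial

/-- The major index of a permutation of `Fin n` (positions taken 1-based): the sum of the
(1-based) positions `i` with `π(i) > π(i+1)`. -/
def majIdx {n : ℕ} (π : Equiv.Perm (Fin n)) : ℕ :=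
  ∑ p ∈ (univ : Finset (Fin n × Fin n)).filter
      (fun p => p.2.val = p.1.val + 1 ∧ π p.2 < π p.1), (p.1.val + 1)

/-- `F n i` is the generating function (in `ℤ[q]`) of the major index over permutations of
`{1,…,n}` whose last entry is `i` (entries taken 1-based, so the last entry of
`π : Equiv.Perm (Fin n)` is `(π ⟨n-1, _⟩).val + 1`). -/
noncomputable def F (n i : ℕ) : Polynomial ℤ :=
  ∑ π ∈ (univ : Finset (Equiv.Perm (Fin n))).filter
      (fun π => ∀ h : n - 1 < n, (π ⟨n - 1, h⟩).val + 1 = i),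
    X ^ majIdx π

theorem majIdx_succ_eq_sum {m : ℕ} (π : Equiv.Perm (Fin (m + 1))) :
    majIdx π = ∑ a : Fin m, if π a.succ < π a.castSucc then a.val + 1 else 0 := by
  rw [← sum_filter]
  symm
  refine sum_bij (fun a _ => (a.castSucc, a.succ)) ?_ ?_ ?_ ?_
  · simp
  · simp
  · rintro ⟨x, y⟩ h
    simp only [mem_filter, mem_univ, true_and] at h
    have hx : x.val < m := by omega
    have h₁ : (⟨x.val, hx⟩ : Fin m).castSucc = x := rfl
    have h₂ : (⟨x.val, hx⟩ : Fin m).succ = y := Fin.ext h.1.symm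
    exact ⟨⟨x.val, hx⟩, by simpa [h₁, h₂] using h.2, by rw [h₁, h₂]⟩
  · simp

/-- The permutation of `Fin (m + 1)` with last entry `i` whose other entries are in the same
relative order as those of `σ`. -/
def permSnoc {m : ℕ} (i : Fin (m + 1)) (σ : Equiv.Perm (Fin m)) : Equiv.Perm (Fin (m + 1)) :=
  (finSuccEquivLast.trans σ.optionCongr).trans (finSuccEquiv' i).symm

@[simp]
theorem permSnoc_last {m : ℕ} (i : Fin (m + 1)) (σ : Equiv.Perm (Fin m)) :
    permSnoc i σ (Fin.last m) = i := by
  simp [permSnoc]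

@[simp]
theorem permSnoc_castSucc {m : ℕ} (i : Fin (m + 1)) (σ : Equiv.Perm (Fin m)) (a : Fin m) :
    permSnoc i σ a.castSucc = i.succAbove (σ a) := by
  simp [permSnoc]

theorem permSnoc_injective {m : ℕ} (i : Fin (m + 1)) : Function.Injective (permSnoc i) := by
  intro σ τ h
  ext a
  have := congrArg (fun π => π a.castSucc) h
  simp only [permSnoc_castSucc, Fin.succAbove_right_inj] at this
  rw [this]

theorem exists_permSnoc_eq {m : ℕ} (π : Equiv.Perm (Fin (m + 1))) :
    ∃ σ, permSnoc (π (Fin.last m)) σ = π := by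
  have h (a : Fin m) : ∃ b, (π (Fin.last m)).succAbove b = π a.castSucc :=
    Fin.exists_succAbove_eq (π.injective.ne (Fin.castSucc_lt_last a).ne)
  choose f hf using h
  have hinj : Function.Injective f := fun a b hab =>
    Fin.castSucc_injective m (π.injective (by rw [← hf, ← hf, hab]))
  refine ⟨Equiv.ofBijective f hinj.bijective_of_finite, Equiv.ext fun x => ?_⟩
  induction x using Fin.lastCases with
  | last => simp
  | cast a => simp [hf]

theorem majIdx_permSnoc {k : ℕ} (i : Fin (k + 2)) (σ : Equiv.Perm (Fin (k + 1))) :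
    majIdx (permSnoc i σ) =
      majIdx σ + if i.val ≤ (σ (Fin.last k)).val then k + 1 else 0 := by
  rw [majIdx_succ_eq_sum, majIdx_succ_eq_sum, Fin.sum_univ_castSucc]
  congr 1
  · refine sum_congr rfl fun a _ => ?_
    rw [Fin.succ_castSucc, permSnoc_castSucc, permSnoc_castSucc]
    simp [Fin.succAbove_lt_succAbove_iff]
  · rw [Fin.succ_last, permSnoc_last, permSnoc_castSucc]
    simp [Fin.lt_succAbove_iff_le_castSucc, Fin.le_def]

theorem F_add_two (k i : ℕ) (hi : i < k + 2) :
    F (k + 2) (i + 1) = ∑ σ : Equiv.Perm (Fin (k + 1)),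
      X ^ majIdx σ * if i ≤ (σ (Fin.last k)).val then X ^ (k + 1) else 1 := by
  symm
  refine sum_bij (fun σ _ => permSnoc ⟨i, hi⟩ σ) ?_ ?_ ?_ ?_
  · intro σ _
    simp only [mem_filter, mem_univ, true_and]
    intro h
    exact congrArg (fun x : Fin (k + 2) => x.val + 1) (permSnoc_last ⟨i, hi⟩ σ)
  · exact fun _ _ _ _ h => permSnoc_injective _ h
  · intro π hπ
    simp only [mem_filter, mem_univ, true_and] at hπ
    have hlast : π (Fin.last (k + 1)) = ⟨i, hi⟩ := Fin.ext (Nat.succ_injective (hπ (by omega)))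
    obtain ⟨σ, hσ⟩ := exists_permSnoc_eq π
    exact ⟨σ, mem_univ _, hlast ▸ hσ⟩
  · intro σ _
    rw [majIdx_permSnoc]
    split_ifs <;> simp [pow_add]

theorem F_succ (k i : ℕ) :
    F (k + 1) i = ∑ σ : Equiv.Perm (Fin (k + 1)),
      if (σ (Fin.last k)).val + 1 = i then X ^ majIdx σ else 0 := by
  rw [F, sum_filter]
  refine sum_congr rfl fun σ _ => if_congr ⟨fun h => h (by omega), fun h _ => h⟩ rfl rfl

/-- For `n ≥ 2`, the polynomials `F(n,i)` satisfy:
(a) for `1 ≤ i ≤ n−1`, `F(n,i)(q) − F(n,i+1)(q) = −(1 − q^{n−1}) · F(n−1,i)(q)`, and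
(b) `F(n,n)(q) = Σ_{j=1}^{n−1} F(n−1,j)(q)`. -/
theorem F_recurrences (n : ℕ) (hn : 2 ≤ n) :
    (∀ i : ℕ, 1 ≤ i → i ≤ n - 1 →
        F n i - F n (i + 1) = -(1 - X ^ (n - 1)) * F (n - 1) i) ∧
      F n n = ∑ j ∈ Finset.Icc 1 (n - 1), F (n - 1) j := by
  obtain ⟨k, rfl⟩ : ∃ k, n = k + 2 := ⟨n - 2, by omega⟩
  simp only [Nat.add_succ_sub_one]
  refine ⟨fun i hi hik => ?_, ?_⟩
  · obtain ⟨i, rfl⟩ : ∃ j, i = j + 1 := ⟨i - 1, by omega⟩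
    rw [F_add_two k i (by omega), F_add_two k (i + 1) (by omega), F_succ, mul_sum,
      ← sum_sub_distrib]
    refine sum_congr rfl fun σ _ => ?_
    split_ifs <;> first | omega | ring
  · rw [F_add_two k (k + 1) (by omega)]
    simp only [F_succ]
    rw [sum_comm]
    refine sum_congr rfl fun σ _ => ?_
    have hσ := (σ (Fin.last k)).isLt
    rw [sum_ite_eq, if_neg (by omega), if_pos (mem_Icc.2 (by omega)), mul_one]
end

section
/- For all integers n ≥ 1 and 1 ≤ i ≤ n, F(n,i)(q) = q^{n−i} · F(n,n)(q); that is, the generating function of the major index over permutations of {1,…,n} ending in i equals q^{n−i} times the generating function over permutations ending in n. -/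
open Finset Polynomial

theorem majIdx_eq_sum {m : ℕ} (π : Equiv.Perm (Fin (m + 1))) :
    majIdx π = ∑ j : Fin m, (j.val + 1) * if π j.succ < π j.castSucc then 1 else 0 := by
  simp only [mul_ite, mul_one, mul_zero]
  rw [majIdx, ← Finset.sum_filter]
  symm
  refine Finset.sum_bij (fun j _ => (j.castSucc, j.succ)) ?_ ?_ ?_ ?_
  · intro j hj
    simpa using hj
  · intro a _ b _ h
    simpa using h
  · rintro ⟨a, b⟩ h
    simp only [mem_filter, mem_univ, true_and] at h
    obtain ⟨h1, h2⟩ := h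
    have hb := b.isLt
    have ha : (⟨a.val, by omega⟩ : Fin m).castSucc = a := rfl
    have hb' : (⟨a.val, by omega⟩ : Fin m).succ = b := Fin.ext h1.symm
    refine ⟨⟨a.val, by omega⟩, ?_, ?_⟩
    · rw [mem_filter, ha, hb']
      exact ⟨mem_univ _, h2⟩
    · rw [ha, hb']
  · intro j _
    rfl

/-- Cyclically shifting two distinct values changes whether they form a descent only when one of
them is the maximum. -/
theorem descent_finRotate {m : ℕ} {a b : Fin (m + 1)} (hab : a ≠ b) :
    ((if finRotate (m + 1) b < finRotate (m + 1) a then 1 else 0) +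
        if a = Fin.last m then 1 else 0 : ℕ) =
      (if b < a then 1 else 0) + if b = Fin.last m then 1 else 0 := by
  have hab' : a.val ≠ b.val := fun h => hab (Fin.ext h)
  have ha := a.isLt
  have hb := b.isLt
  simp only [Fin.lt_def, coe_finRotate, Fin.ext_iff, Fin.val_last]
  split_ifs <;> omega

/-- Cyclically shifting the values of a permutation whose last entry is not maximal lowers its
major index by one. -/
theorem majIdx_trans_finRotate {m : ℕ} (π : Equiv.Perm (Fin (m + 1)))
    (h : π (Fin.last m) ≠ Fin.last m) :
    majIdx π = majIdx (π.trans (finRotate (m + 1))) + 1 := by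
  set e : Fin (m + 1) → ℕ := fun j => if π j = Fin.last m then 1 else 0 with he
  have hsum : ∑ j, e j = 1 := by
    simp [he, ← Equiv.eq_symm_apply]
  have hlast : e (Fin.last m) = 0 := by simp [he, h]
  have hsucc := Fin.sum_univ_succ fun j : Fin (m + 1) => j.val * e j
  have hcast := Fin.sum_univ_castSucc fun j : Fin (m + 1) => (j.val + 1) * e j
  have key : majIdx (π.trans (finRotate (m + 1))) + ∑ j : Fin m, (j.val + 1) * e j.castSucc =
      majIdx π + ∑ j : Fin m, (j.val + 1) * e j.succ := by
    rw [majIdx_eq_sum, majIdx_eq_sum, ← Finset.sum_add_distrib, ← Finset.sum_add_distrib]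
    refine Finset.sum_congr rfl fun j _ => ?_
    rw [← mul_add, ← mul_add]
    exact congrArg _ (descent_finRotate fun hj => Fin.castSucc_lt_succ.ne (π.injective hj))
  simp only [add_mul, one_mul, Finset.sum_add_distrib, Fin.val_zero, zero_mul, zero_add,
    Fin.val_succ, Fin.val_castSucc, hlast, mul_zero, add_zero, hsum] at hsucc hcast key
  omega

theorem F_succ_eq_sum (m i : ℕ) :
    F (m + 1) i = ∑ π : Equiv.Perm (Fin (m + 1)) with (π (Fin.last m)).val + 1 = i,
      X ^ majIdx π := by
  refine Finset.sum_congr (Finset.filter_congr fun π _ => ?_) fun _ _ => rfl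
  exact ⟨fun h => h (Nat.lt_succ_self m), fun h _ => h⟩

theorem F_eq_X_mul_F_succ {m i : ℕ} (hi1 : 1 ≤ i) (hi2 : i < m + 1) :
    F (m + 1) i = X * F (m + 1) (i + 1) := by
  rw [F_succ_eq_sum, F_succ_eq_sum, Finset.mul_sum]
  have hne (π : Equiv.Perm (Fin (m + 1))) (h : (π (Fin.last m)).val + 1 = i) :
      π (Fin.last m) ≠ Fin.last m := by
    rw [Ne, Fin.ext_iff, Fin.val_last]
    omega
  refine Finset.sum_bij (fun π _ => π.trans (finRotate (m + 1))) ?_ ?_ ?_ ?_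
  · intro π hπ
    rw [mem_filter_univ] at hπ ⊢
    rw [Equiv.trans_apply, coe_finRotate_of_ne_last (hne π hπ), hπ]
  · intro π _ σ _ h
    exact Equiv.ext fun j => (finRotate (m + 1)).injective (Equiv.congr_fun h j)
  · intro σ hσ
    rw [mem_filter_univ] at hσ
    refine ⟨σ.trans (finRotate (m + 1)).symm, ?_, by ext; simp⟩
    rw [mem_filter_univ, Equiv.trans_apply]
    have h := coe_finRotate ((finRotate (m + 1)).symm (σ (Fin.last m)))
    rw [Equiv.apply_symm_apply] at h
    split_ifs at h <;> omega
  · intro π hπ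
    rw [mem_filter_univ] at hπ
    rw [majIdx_trans_finRotate π (hne π hπ), pow_succ']

/-- For `n ≥ 1` and `1 ≤ i ≤ n`, `F(n,i)(q) = q^{n−i} · F(n,n)(q)`. -/
theorem F_eq_pow_mul_F_last (n i : ℕ) (hn : 1 ≤ n) (hi1 : 1 ≤ i) (hi2 : i ≤ n) :
    F n i = X ^ (n - i) * F n n := by
  obtain ⟨m, rfl⟩ : ∃ m, n = m + 1 := ⟨n - 1, by omega⟩
  induction hi2 using Nat.decreasingInduction with
  | self => simp
  | of_succ k hk ih =>
    rw [F_eq_X_mul_F_succ hi1 hk, ih (by omega), ← mul_assoc, ← pow_succ']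
    congr 2
    omega
end

section
/- For every integer k ≥ 0, Σ_{i=k}^{2k} (−1/2)^{2k−i} · C(2k,i) · Σ_{j=i−k}^{i} 2^{−j} · S(i,j) · s(j, i−k) = (2k)!/(8^k · k!), where C(2k,i) is the binomial coefficient. -/
open Finset

/-- Stirling numbers of the second kind: `S(0,0)=1`, `S(i,0)=0` for `i ≥ 1`, `S(0,j)=0` for
`j ≥ 1`, and `S(i,j) = j·S(i−1,j) + S(i−1,j−1)`. -/
def stirling2 : ℕ → ℕ → ℕ
  | 0, 0 => 1
  | 0, _ + 1 => 0
  | _ + 1, 0 => 0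
  | i + 1, j + 1 => (j + 1) * stirling2 i (j + 1) + stirling2 i j

/-- Signed Stirling numbers of the first kind: `s(j,m)` is the coefficient of `x^m` in
`∏_{t=0}^{j−1}(x−t)`. -/
noncomputable def stirling1 (j m : ℕ) : ℤ :=
  (∏ t ∈ Finset.range j, (Polynomial.X - Polynomial.C (t : ℤ))).coeff m

open Polynomial in
theorem stirling1_eq_coeff_descPochhammer (j m : ℕ) :
    (stirling1 j m : ℚ) = (descPochhammer ℚ j).coeff m := by
  have h : ∏ t ∈ Finset.range j, (X - C (t : ℤ)) = descPochhammer ℤ j := by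
    induction j with
    | zero => simp
    | succ j ih => rw [Finset.prod_range_succ, ih, descPochhammer_succ_right]; simp
  rw [stirling1, h, ← descPochhammer_map (Int.castRingHom ℚ), coeff_map]
  simp

theorem stirling2_eq_zero_of_lt {i j : ℕ} (h : i < j) : stirling2 i j = 0 := by
  induction i generalizing j with
  | zero => cases j with
    | zero => omega
    | succ j => simp [stirling2]
  | succ i ih => cases j with
    | zero => omega
    | succ j => simp [stirling2, ih (show i < j + 1 by omega), ih (show i < j by omega)]

open Polynomial in
/-- The polynomial whose value at `N` is the `i`-th moment of a binomial variable with
parameters `N` and `1/2`. -/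
noncomputable def binomialMoment (i : ℕ) : ℚ[X] :=
  ∑ j ∈ range (i + 1), C ((1 / 2 : ℚ) ^ j * (stirling2 i j : ℚ)) * descPochhammer ℚ j

open Polynomial in
theorem binomialMoment_succ (i : ℕ) :
    binomialMoment (i + 1) =
      X * binomialMoment i - C (1 / 2) * (X * (binomialMoment i).comp (X - 1)) := by
  have shift : ∑ j ∈ range (i + 1), (j : ℚ[X]) * (C ((1 / 2 : ℚ) ^ j * (stirling2 i j : ℚ)) *
        descPochhammer ℚ j) = ∑ j ∈ range (i + 1), ((j + 1 : ℕ) : ℚ[X]) *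
          (C ((1 / 2 : ℚ) ^ (j + 1) * (stirling2 i (j + 1) : ℚ)) * descPochhammer ℚ (j + 1)) := by
    have h := Finset.sum_range_succ (fun j => (j : ℚ[X]) *
      (C ((1 / 2 : ℚ) ^ j * (stirling2 i j : ℚ)) * descPochhammer ℚ j)) (i + 1)
    rw [Finset.sum_range_succ'] at h
    simpa [stirling2_eq_zero_of_lt (Nat.lt_succ_self i)] using h.symm
  have expand : X * binomialMoment i - C (1 / 2) * (X * (binomialMoment i).comp (X - 1)) =
      ∑ j ∈ range (i + 1), (j : ℚ[X]) * (C ((1 / 2 : ℚ) ^ j * (stirling2 i j : ℚ)) *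
        descPochhammer ℚ j) +
      ∑ j ∈ range (i + 1), C ((1 / 2 : ℚ) ^ (j + 1) * (stirling2 i j : ℚ)) *
        descPochhammer ℚ (j + 1) := by
    simp only [binomialMoment, Polynomial.sum_comp, mul_comp, C_comp, Finset.mul_sum,
      ← Finset.sum_sub_distrib, ← Finset.sum_add_distrib]
    refine Finset.sum_congr rfl fun j _ => ?_
    have hl := descPochhammer_succ_left ℚ j
    have hr := descPochhammer_succ_right ℚ j
    have hc : (C (1 / 2 : ℚ) : ℚ[X]) + C (1 / 2) = 1 := by
      rw [← C_add]; norm_num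
    simp only [pow_succ, C_mul]
    linear_combination C ((1 / 2 : ℚ) ^ j) * C (stirling2 i j : ℚ) *
      (C (1 / 2) * hl - hr - hc * descPochhammer ℚ (j + 1))
  rw [expand, shift, binomialMoment, Finset.sum_range_succ', ← Finset.sum_add_distrib]
  simp only [stirling2, Nat.cast_zero, mul_zero, C_0, zero_mul, add_zero]
  refine Finset.sum_congr rfl fun j _ => ?_
  simp only [Nat.cast_add, Nat.cast_mul, Nat.cast_one, C_mul, C_add, map_natCast, map_one]
  ring

theorem binomialMoment_eval (i N : ℕ) :
    (binomialMoment i).eval (N : ℚ) * 2 ^ N =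
      ∑ m ∈ range (N + 1), (N.choose m : ℚ) * (m : ℚ) ^ i := by
  induction i generalizing N with
  | zero =>
    have h := Nat.sum_range_choose N
    simp [binomialMoment, stirling2]
    exact_mod_cast h.symm
  | succ i ih =>
    rw [binomialMoment_succ]
    cases N with
    | zero => simp
    | succ N =>
      have key : ∑ m ∈ range (N + 1 + 1), ((N + 1).choose m : ℚ) * (m : ℚ) ^ (i + 1) =
          (N + 1) * ∑ m ∈ range (N + 1 + 1), ((N + 1).choose m : ℚ) * (m : ℚ) ^ i -
          (N + 1) * ∑ m ∈ range (N + 1), (N.choose m : ℚ) * (m : ℚ) ^ i := by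
        have h : ∑ m ∈ range (N + 1), (N.choose m : ℚ) * (m : ℚ) ^ i =
            ∑ m ∈ range (N + 1 + 1), (N.choose m : ℚ) * (m : ℚ) ^ i := by
          rw [Finset.sum_range_succ _ (N + 1)]; simp
        rw [h, Finset.mul_sum, Finset.mul_sum, ← Finset.sum_sub_distrib]
        refine Finset.sum_congr rfl fun m hm => ?_
        have hm' : m ≤ N + 1 := by simpa [Nat.lt_succ_iff] using hm
        have hc := Nat.choose_mul_succ_eq N m
        have hc' : (N.choose m : ℚ) * (N + 1) = ((N + 1).choose m : ℚ) * (N + 1 - m) := by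
          have := congrArg (Nat.cast : ℕ → ℚ) hc
          push_cast [Nat.cast_sub hm'] at this
          exact this
        linear_combination (m : ℚ) ^ i * hc'
      rw [key, ← ih, ← ih]
      simp
      ring

open Polynomial in
/-- The polynomial whose value at `N` is the `n`-th central moment of a binomial variable with
parameters `N` and `1/2`. -/
noncomputable def binomialCentralMoment (n : ℕ) : ℚ[X] :=
  ∑ i ∈ range (n + 1),
    C ((-1 / 2 : ℚ) ^ (n - i) * (n.choose i : ℚ)) * (binomialMoment i * X ^ (n - i))

theorem binomialCentralMoment_eval (n N : ℕ) :
    (binomialCentralMoment n).eval (N : ℚ) * 2 ^ N =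
      ∑ m ∈ range (N + 1), (N.choose m : ℚ) * (m - N / 2 : ℚ) ^ n := by
  have h (m : ℕ) : (N.choose m : ℚ) * (m - N / 2 : ℚ) ^ n = ∑ i ∈ range (n + 1),
      (-1 / 2 : ℚ) ^ (n - i) * (n.choose i : ℚ) * (N : ℚ) ^ (n - i) *
        ((N.choose m : ℚ) * (m : ℚ) ^ i) := by
    rw [show (m - N / 2 : ℚ) = m + (-1 / 2) * N by ring, add_pow, Finset.mul_sum]
    refine Finset.sum_congr rfl fun i _ => ?_
    rw [mul_pow]; ring
  simp only [h]
  rw [Finset.sum_comm]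
  simp only [← Finset.mul_sum, ← binomialMoment_eval]
  simp only [binomialCentralMoment, Polynomial.eval_finsetSum, Finset.sum_mul]
  refine Finset.sum_congr rfl fun i _ => ?_
  simp only [Polynomial.eval_mul, Polynomial.eval_C, Polynomial.eval_pow, Polynomial.eval_X]
  ring

theorem sum_choose_mul_sub_half_pow_add_two (n N : ℕ) :
    ∑ m ∈ range (N + 3), ((N + 2).choose m : ℚ) * (m - (N + 2) / 2 : ℚ) ^ (n + 2) =
      (N + 2) ^ 2 / 4 * ∑ m ∈ range (N + 3), ((N + 2).choose m : ℚ) * (m - (N + 2) / 2 : ℚ) ^ n -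
      (N + 2) * (N + 1) * ∑ m ∈ range (N + 1), (N.choose m : ℚ) * (m - N / 2 : ℚ) ^ n := by
  have h : ∑ m ∈ range (N + 3),
      ((N + 2).choose m : ℚ) * (m * (N + 2 - m)) * (m - (N + 2) / 2 : ℚ) ^ n =
      (N + 2) * (N + 1) * ∑ m ∈ range (N + 1), (N.choose m : ℚ) * (m - N / 2 : ℚ) ^ n := by
    rw [Finset.sum_range_succ, Finset.sum_range_succ', Finset.mul_sum]
    have hz (c d : ℚ) : c * (((N + 2 : ℕ) : ℚ) * (N + 2 - ((N + 2 : ℕ) : ℚ))) * d = 0 := by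
      push_cast; ring
    rw [hz, add_zero]
    simp only [Nat.cast_zero, zero_mul, mul_zero, add_zero]
    refine Finset.sum_congr rfl fun m hm => ?_
    have hm' : m ≤ N := by simpa [Nat.lt_succ_iff] using hm
    have h1 : ((N : ℚ) + 2) * (N + 1).choose m = (N + 2).choose (m + 1) * (m + 1) := by
      exact_mod_cast Nat.add_one_mul_choose_eq (N + 1) m
    have h2 : (N.choose m : ℚ) * (N + 1) = (N + 1).choose m * (N + 1 - m) := by
      have := congrArg (Nat.cast : ℕ → ℚ) (Nat.choose_mul_succ_eq N m)
      push_cast [Nat.cast_sub (show m ≤ N + 1 by omega)] at this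
      exact this
    have h3 : (((m + 1 : ℕ) : ℚ) - (N + 2) / 2) = m - N / 2 := by push_cast; ring
    rw [h3]
    push_cast
    linear_combination (m - N / 2 : ℚ) ^ n * (-(N + 1 - m : ℚ) * h1 - (N + 2) * h2)
  rw [← h, Finset.mul_sum, ← Finset.sum_sub_distrib]
  refine Finset.sum_congr rfl fun m _ => ?_
  ring

open Polynomial in
theorem binomialCentralMoment_add_two (n : ℕ) :
    binomialCentralMoment (n + 2) = C (1 / 4) * (X * (X * binomialCentralMoment n -
      (X - 1) * (binomialCentralMoment n).comp (X - 2))) := by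
  refine eq_of_infinite_eval_eq _ _ (Set.infinite_of_injective_forall_mem
    (f := fun N : ℕ => ((N + 2 : ℕ) : ℚ)) ?_ fun N => ?_)
  · intro a b hab
    simpa using hab
  · have h0 := binomialCentralMoment_eval n N
    have h1 := binomialCentralMoment_eval n (N + 2)
    have h2 := binomialCentralMoment_eval (n + 2) (N + 2)
    have h3 := sum_choose_mul_sub_half_pow_add_two n N
    push_cast at h1 h2
    rw [← h0, ← h1, ← h2] at h3
    have hp : (2 : ℚ) ^ N ≠ 0 := by positivity
    simp only [Set.mem_ofPred_eq, eval_mul, eval_sub, eval_comp, eval_X, eval_C, eval_one,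
      eval_ofNat, Nat.cast_add, Nat.cast_ofNat, add_sub_cancel_right]
    apply mul_right_cancel₀ (mul_ne_zero hp (four_ne_zero (α := ℚ)))
    linear_combination h3

open Polynomial in
theorem X_mul_sub_comp_X_pow (m : ℕ) :
    (X * X ^ m - (X - 1) * (X - 2) ^ m : ℚ[X]).natDegree ≤ m ∧
      (X * X ^ m - (X - 1) * (X - 2) ^ m : ℚ[X]).coeff m = 2 * m + 1 := by
  induction m with
  | zero => simp
  | succ m ih =>
    have step : (X * X ^ (m + 1) - (X - 1) * (X - 2) ^ (m + 1) : ℚ[X]) =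
        X * (X * X ^ m - (X - 1) * (X - 2) ^ m) + C 2 * ((X - C 1) * (X - C 2) ^ m) := by
      simp only [map_ofNat, map_one]; ring
    have hm : ((X - C 1) * (X - C 2) ^ m : ℚ[X]).Monic :=
      (monic_X_sub_C 1).mul ((monic_X_sub_C 2).pow m)
    have hd : ((X - C 1) * (X - C 2) ^ m : ℚ[X]).natDegree = m + 1 := by
      rw [(monic_X_sub_C 1).natDegree_mul ((monic_X_sub_C 2).pow m),
        (monic_X_sub_C 2).natDegree_pow, natDegree_X_sub_C, natDegree_X_sub_C]
      ring
    have hcoeff : ((X - C 1) * (X - C 2) ^ m : ℚ[X]).coeff (m + 1) = 1 := by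
      rw [← hd]; exact hm
    rw [step]
    constructor
    · refine natDegree_add_le_of_degree_le ?_ ((natDegree_C_mul_le _ _).trans hd.le)
      refine natDegree_mul_le.trans ?_
      rw [natDegree_X]
      omega
    · rw [coeff_add, coeff_X_mul, coeff_C_mul, hcoeff, ih.2]
      push_cast; ring

open Polynomial in
theorem X_mul_sub_comp {p : ℚ[X]} {k : ℕ} (hp : p.natDegree ≤ k) :
    (X * p - (X - 1) * p.comp (X - 2)).natDegree ≤ k ∧
      (X * p - (X - 1) * p.comp (X - 2)).coeff k = (2 * k + 1) * p.coeff k := by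
  have h : X * p - (X - 1) * p.comp (X - 2) = ∑ m ∈ range (k + 1),
      C (p.coeff m) * (X * X ^ m - (X - 1) * (X - 2) ^ m) := by
    have hs := as_sum_range_C_mul_X_pow' p (show p.natDegree < k + 1 by omega)
    conv_lhs => rw [hs]
    simp only [Polynomial.sum_comp, mul_comp, C_comp, pow_comp, X_comp, Finset.mul_sum,
      ← Finset.sum_sub_distrib]
    refine Finset.sum_congr rfl fun m _ => ?_
    ring
  rw [h]
  constructor
  · refine natDegree_sum_le_of_forall_le _ _ fun m hm => ?_
    have := (X_mul_sub_comp_X_pow m).1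
    have hm' := Finset.mem_range.1 hm
    exact (natDegree_C_mul_le _ _).trans (by omega)
  · rw [finsetSum_coeff, Finset.sum_range_succ, Finset.sum_eq_zero, coeff_C_mul,
      (X_mul_sub_comp_X_pow k).2]
    · ring
    · intro m hm
      rw [coeff_C_mul,
        coeff_eq_zero_of_natDegree_lt (p := X * X ^ m - (X - 1) * (X - 2) ^ m), mul_zero]
      exact (X_mul_sub_comp_X_pow m).1.trans_lt (Finset.mem_range.1 hm)

open Polynomial in
theorem binomialCentralMoment_two_mul (k : ℕ) :
    (binomialCentralMoment (2 * k)).natDegree ≤ k ∧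
      (binomialCentralMoment (2 * k)).coeff k =
        ((2 * k).factorial : ℚ) / (8 ^ k * (k.factorial : ℚ)) := by
  induction k with
  | zero => simp [binomialCentralMoment, binomialMoment, stirling2]
  | succ k ih =>
    obtain ⟨hd, hc⟩ := X_mul_sub_comp ih.1
    rw [show 2 * (k + 1) = 2 * k + 2 by ring, binomialCentralMoment_add_two]
    constructor
    · refine (natDegree_C_mul_le _ _).trans (natDegree_mul_le.trans ?_)
      rw [natDegree_X]
      omega
    · rw [coeff_C_mul, coeff_X_mul, hc, ih.2]
      have hk : (k.factorial : ℚ) ≠ 0 := by positivity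
      have hk' : (k : ℚ) + 1 ≠ 0 := by positivity
      simp only [Nat.factorial_succ]
      push_cast
      field_simp
      ring

theorem binomialMoment_coeff (i m : ℕ) :
    (binomialMoment i).coeff m =
      ∑ j ∈ Finset.Icc m i, (1 / 2 : ℚ) ^ j * (stirling2 i j : ℚ) * (stirling1 j m : ℚ) := by
  simp only [binomialMoment, Polynomial.finsetSum_coeff, Polynomial.coeff_C_mul,
    stirling1_eq_coeff_descPochhammer]
  symm
  refine Finset.sum_subset (fun j hj => ?_) fun j hj hj' => ?_
  · simp only [Finset.mem_Icc, Finset.mem_range] at hj ⊢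
    omega
  · simp only [Finset.mem_Icc, Finset.mem_range] at hj hj'
    rw [Polynomial.coeff_eq_zero_of_natDegree_lt, mul_zero]
    rw [descPochhammer_natDegree]
    omega

/-- For every `k ≥ 0`,
`Σ_{i=k}^{2k} (−1/2)^{2k−i} C(2k,i) Σ_{j=i−k}^{i} 2^{−j} S(i,j) s(j,i−k) = (2k)!/(8^k k!)`. -/
theorem stirling_identity_diagonal (k : ℕ) :
    ∑ i ∈ Finset.Icc k (2 * k), (-1 / 2 : ℚ) ^ (2 * k - i) * ((2 * k).choose i : ℚ) *
        ∑ j ∈ Finset.Icc (i - k) i,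
          (1 / 2 : ℚ) ^ j * (stirling2 i j : ℚ) * (stirling1 j (i - k) : ℚ) =
      ((2 * k).factorial : ℚ) / (8 ^ k * (k.factorial : ℚ)) := by
  rw [← (binomialCentralMoment_two_mul k).2, binomialCentralMoment, Polynomial.finsetSum_coeff]
  simp only [← binomialMoment_coeff, Polynomial.coeff_C_mul, Polynomial.coeff_mul_X_pow']
  refine Finset.sum_subset_zero_on_sdiff (fun i hi => ?_) (fun i hi => ?_) fun i hi => ?_
  · simp only [Finset.mem_Icc, Finset.mem_range] at hi ⊢
    omega
  · simp only [Finset.mem_sdiff, Finset.mem_Icc, Finset.mem_range] at hi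
    rw [if_neg (by omega), mul_zero]
  · have hi' := Finset.mem_Icc.1 hi
    rw [if_pos (by omega), show k - (2 * k - i) = i - k by omega]
end
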